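/- arXiv:1305.5372 — 2 statements merged into one kernel-verified Lean document; each statement's English description precedes it below -/
import Mathlib

section
/- Let k ≥ 3 and t ≥ 1 be integers. There exists n₀ such that for all n ≥ n₀, any k-uniform hypergraph on vertex set [n] with exactly C(n−1,k−1) + … + C(n−t,k−1) + C(n−t−2,k−2) edges and containing no k-uniform linear path of length 2t+2 consists exactly of all k-subsets of [n] that meet some fixed t-element set S, together with all k-subsets of [n]∖S that contain some two fixed elements of [n]∖S. -/
/-- A `k`-uniform linear path of length `ℓ`: a list of `k`-sets `F₁, …, F_ℓ` such that
`|F_i ∩ F_{i+1}| = 1` for consecutive sets and `F_i ∩ F_j = ∅` whenever `|i - j| > 1`. -/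
def IsLinearPath (k ℓ : ℕ) {n : ℕ} (A : Fin ℓ → Finset (Fin n)) : Prop :=
  (∀ i, (A i).card = k) ∧
  (∀ i j : Fin ℓ, (j : ℕ) = (i : ℕ) + 1 → (A i ∩ A j).card = 1) ∧
  (∀ i j : Fin ℓ, (i : ℕ) + 1 < (j : ℕ) → Disjoint (A i) (A j))

section LinearPaths

open Finset
open scoped Classical

/-- A sequence with prescribed unary and pairwise properties can be chosen greedily. -/
theorem exists_seq_of_greedy {α : Type*} [Nonempty α] (M : ℕ) (Q : ℕ → α → Prop)
    (R : ℕ → ℕ → α → α → Prop)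
    (h : ∀ m < M, ∀ f : ℕ → α, (∀ i < m, Q i (f i)) →
      (∀ i j, i < j → j < m → R i j (f i) (f j)) → ∃ a, Q m a ∧ ∀ i < m, R i m (f i) a) :
    ∃ f : ℕ → α, (∀ i < M, Q i (f i)) ∧ ∀ i j, i < j → j < M → R i j (f i) (f j) := by
  induction M with
  | zero => exact ⟨fun _ => Classical.arbitrary α, by simp, by simp⟩
  | succ M ih =>
    obtain ⟨f, hQ, hR⟩ := ih fun m hm => h m (by omega)
    obtain ⟨a, ha, hRa⟩ := h M (by omega) f hQ hR
    refine ⟨Function.update f M a, fun i hi => ?_, fun i j hij hj => ?_⟩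
    · rcases eq_or_ne i M with rfl | hne
      · simpa using ha
      · simpa [hne] using hQ i (by omega)
    · have hi : i ≠ M := by omega
      rcases eq_or_ne j M with rfl | hne
      · simpa [hi] using hRa i hij
      · simpa [hi, hne] using hR i j hij (by omega)

theorem exists_injective_seq {α : Type*} [Nonempty α] (M : ℕ) (P : α → Prop)
    (h : ∀ W : Finset α, #W < M → ∃ a ∉ W, P a) :
    ∃ f : ℕ → α, (∀ i < M, P (f i)) ∧ ∀ i j, i < j → j < M → f i ≠ f j := by
  refine exists_seq_of_greedy M (fun _ a => P a) (fun _ _ a b => a ≠ b) fun m hm f _ _ => ?_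
  obtain ⟨a, haW, ha⟩ := h ((range m).image f)
    (lt_of_le_of_lt card_image_le (by simpa using hm))
  refine ⟨a, ha, fun i hi hia => haW ?_⟩
  exact hia ▸ mem_image_of_mem f (mem_range.2 hi)

theorem Finset.exists_injective_seq {α : Type*} [Nonempty α] (A : Finset α) :
    ∃ f : ℕ → α, (∀ i < #A, f i ∈ A) ∧ ∀ i j, i < j → j < #A → f i ≠ f j := by
  refine _root_.exists_injective_seq #A (· ∈ A) fun W hW => ?_
  obtain ⟨a, ha, haW⟩ := exists_mem_notMem_of_card_lt_card hW
  exact ⟨a, haW, ha⟩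

/-- Removing at most `D` members of `F` for each test object in `B` leaves a subfamily in which
every test object incident to some member is incident to at least `D` members. -/
theorem exists_full_subfamily {α β : Type*} (F : Finset α) (B : Finset β) (r : α → β → Prop)
    [∀ b, DecidablePred (r · b)] (D : ℝ) (hD : 0 ≤ D) :
    ∃ F' ⊆ F, (#F : ℝ) ≤ #F' + D * #B ∧
      ∀ a ∈ F', ∀ b ∈ B, r a b → D ≤ #{a' ∈ F' | r a' b} := by
  induction B using Finset.strongInduction generalizing F with
  | H B ih =>
    by_cases hF : ∀ a ∈ F, ∀ b ∈ B, r a b → D ≤ #{a' ∈ F | r a' b}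
    · exact ⟨F, Subset.rfl, by nlinarith [Nat.cast_nonneg (α := ℝ) #B], hF⟩
    · push Not at hF
      obtain ⟨a, -, b, hb, -, hlt⟩ := hF
      obtain ⟨F', hF', hcard, hfull⟩ := ih (B.erase b) (erase_ssubset hb) {a' ∈ F | ¬ r a' b}
      refine ⟨F', hF'.trans (filter_subset _ _), ?_, fun a' ha' b' hb' hr => ?_⟩
      · have h1 := card_filter_add_card_filter_not (s := F) (fun a' => r a' b)
        have h2 := card_erase_add_one hb
        have h1' : (#{a' ∈ F | r a' b} : ℝ) + #{a' ∈ F | ¬ r a' b} = #F := by exact_mod_cast h1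
        have h2' : (#(B.erase b) : ℝ) + 1 = #B := by exact_mod_cast h2
        rw [← h2']
        linarith
      · refine hfull a' ha' b' (mem_erase.2 ⟨?_, hb'⟩) hr
        rintro rfl
        exact (mem_filter.1 (hF' ha')).2 hr

/-- If vertices outside `K` can always be exchanged in more than `#W` ways within `F`, then some
member of `F` containing `K` avoids `W`. -/
theorem exists_disjoint_of_exchange {V : Type*} [DecidableEq V] {k : ℕ}
    (F : Finset (Finset V)) (hF : ∀ e ∈ F, #e = k) (K W : Finset V) (hKW : Disjoint K W)
    (hex : ∀ e ∈ F, K ⊆ e → ∀ z ∈ e, z ∉ K → #W < #{e' ∈ F | e.erase z ⊆ e'})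
    {e : Finset V} (he : e ∈ F) (hKe : K ⊆ e) : ∃ e' ∈ F, K ⊆ e' ∧ Disjoint e' W := by
  induction hc : #(e ∩ W) using Nat.strong_induction_on generalizing e with
  | _ c ih =>
    by_cases hd : Disjoint e W
    · exact ⟨e, he, hKe, hd⟩
    · obtain ⟨z, hze, hzW⟩ := not_disjoint_iff.1 hd
      have hzK : z ∉ K := fun h => disjoint_left.1 hKW h hzW
      obtain ⟨e', he', hne⟩ : ∃ e' ∈ {e' ∈ F | e.erase z ⊆ e'},
          e' ∉ W.image (fun y => insert y (e.erase z)) := by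
        refine exists_mem_notMem_of_card_lt_card (lt_of_le_of_lt card_image_le ?_)
        exact hex e he hKe z hze hzK
      obtain ⟨he'F, hsub⟩ := mem_filter.1 he'
      have hKe' : K ⊆ e' := fun v hv =>
        hsub (mem_erase.2 ⟨fun h => hzK (h ▸ hv), hKe hv⟩)
      have hk1 := card_erase_add_one hze
      obtain ⟨y, hy, hye⟩ : ∃ y ∉ e.erase z, insert y (e.erase z) = e' := by
        refine exists_eq_insert_iff.2 ⟨hsub, ?_⟩
        rw [hF e' he'F, ← hF e he, hk1]
      have hyW : y ∉ W := fun h => hne (mem_image.2 ⟨y, h, hye⟩)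
      refine ih #(e' ∩ W) ?_ he'F hKe' rfl
      rw [← hc]
      refine card_lt_card ⟨fun v hv => ?_, fun h => ?_⟩
      · obtain ⟨hv1, hv2⟩ := mem_inter.1 hv
        rw [← hye, mem_insert, mem_erase] at hv1
        rcases hv1 with rfl | hv1
        · exact absurd hv2 hyW
        · exact mem_inter.2 ⟨hv1.2, hv2⟩
      · have := (mem_inter.1 (h (mem_inter.2 ⟨hze, hzW⟩))).1
        rw [← hye, mem_insert, mem_erase] at this
        rcases this with rfl | h'
        · exact hyW hzW
        · exact h'.1 rfl

/-- `H` contains no linear path of length `ℓ`. -/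
def LinearPathFree (k ℓ : ℕ) {n : ℕ} (H : Finset (Finset (Fin n))) : Prop :=
  ¬ ∃ A : Fin ℓ → Finset (Fin n), IsLinearPath k ℓ A ∧ ∀ i, A i ∈ H

/-- The pair `a, b` lies in edges of `H` avoiding any prescribed set of at most `w` vertices. -/
def IsStrongPair {n : ℕ} (H : Finset (Finset (Fin n))) (w : ℕ) (a b : Fin n) : Prop :=
  ∀ W : Finset (Fin n), #W ≤ w → a ∉ W → b ∉ W → ∃ e ∈ H, a ∈ e ∧ b ∈ e ∧ Disjoint e W

theorem IsStrongPair.symm {n : ℕ} {H : Finset (Finset (Fin n))} {w : ℕ} {a b : Fin n}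
    (h : IsStrongPair H w a b) : IsStrongPair H w b a := fun W hW hb ha =>
  let ⟨e, he, h1, h2, h3⟩ := h W hW ha hb
  ⟨e, he, h2, h1, h3⟩

/-- A path `x 0, …, x M` each of whose consecutive pairs is either strong or already covered by a
prescribed edge expands to a linear path. -/
theorem not_linearPathFree_of_joints {n k M w : ℕ} {H : Finset (Finset (Fin n))}
    (hH : ∀ e ∈ H, #e = k) (x : ℕ → Fin n) (hx : ∀ i j, i < j → j ≤ M → x i ≠ x j)
    (p : ℕ → Prop) (E : ℕ → Finset (Fin n))
    (hE : ∀ i < M, p i → E i ∈ H ∧ x i ∈ E i ∧ x (i + 1) ∈ E i ∧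
      ∀ j ≤ M, x j ∈ E i → j = i ∨ j = i + 1)
    (hEE : ∀ i j, i < j → j < M → p i → p j → E i ∩ E j ⊆ {x j})
    (hS : ∀ i < M, ¬ p i → IsStrongPair H w (x i) (x (i + 1)))
    (hw : 2 * (k + 1) * (M + 1) ≤ w) : ¬ LinearPathFree k M H := by
  have hx' : ∀ i j, i ≤ M → j ≤ M → x i = x j → i = j := by
    intro i j hi hj hij
    rcases lt_trichotomy i j with h | h | h
    · exact absurd hij (hx i j h hj)
    · exact h
    · exact absurd hij.symm (hx j i h hi)
  set X : Finset (Fin n) := (range (M + 1)).image x with hX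
  have hmX : ∀ j ≤ M, x j ∈ X := fun j hj => mem_image_of_mem x (mem_range.2 (by omega))
  set Z : Finset (Fin n) := {i ∈ range M | p i}.biUnion E with hZ
  have hZc : #Z ≤ M * k := by
    refine card_biUnion_le.trans ((sum_le_card_nsmul _ _ k fun i hi => ?_).trans ?_)
    · obtain ⟨hi, hpi⟩ := mem_filter.1 hi
      exact (hH _ (hE i (mem_range.1 hi) hpi).1).le
    · rw [smul_eq_mul]
      exact Nat.mul_le_mul_right _ ((card_filter_le _ _).trans (by simp))
  obtain ⟨A, hA, hAA⟩ := exists_seq_of_greedy M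
    (fun i e => e ∈ H ∧ x i ∈ e ∧ x (i + 1) ∈ e ∧ (∀ j ≤ M, x j ∈ e → j = i ∨ j = i + 1) ∧
      (¬ p i → e ∩ Z ⊆ X) ∧ (p i → e = E i))
    (fun i j e e' => e ∩ e' ⊆ {x j}) (by
      intro m hm f hQ hR
      by_cases hpm : p m
      · obtain ⟨h1, h2, h3, h4⟩ := hE m hm hpm
        refine ⟨E m, ⟨h1, h2, h3, h4, fun h => absurd hpm h, fun _ => rfl⟩, fun i hi => ?_⟩
        obtain ⟨-, -, -, q4, q5, q6⟩ := hQ i hi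
        by_cases hpi : p i
        · rw [q6 hpi]
          exact hEE i m hi hm hpi hpm
        · intro v hv
          obtain ⟨hv1, hv2⟩ := mem_inter.1 hv
          have hvX : v ∈ X := q5 hpi (mem_inter.2 ⟨hv1, mem_biUnion.2
            ⟨m, mem_filter.2 ⟨mem_range.2 hm, hpm⟩, hv2⟩⟩)
          obtain ⟨j, hj, rfl⟩ := mem_image.1 hvX
          have hj := mem_range.1 hj
          have a1 := q4 j (by omega) hv1
          have a2 := h4 j (by omega) hv2
          have : j = m := by omega
          simp [this]
      · set U : Finset (Fin n) := ((range m).biUnion f ∪ Z ∪ X) \ {x m, x (m + 1)} with hU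
        have hfc : #((range m).biUnion f) ≤ M * k := by
          refine card_biUnion_le.trans ((sum_le_card_nsmul _ _ k fun i hi => ?_).trans ?_)
          · exact (hH _ (hQ i (mem_range.1 hi)).1).le
          · rw [smul_eq_mul, card_range]
            exact Nat.mul_le_mul_right _ hm.le
        have hXc : #X ≤ M + 1 := card_image_le.trans (by simp)
        have hUc : #U ≤ w := by
          have h1 : #U ≤ #((range m).biUnion f ∪ Z ∪ X) := card_le_card sdiff_subset
          have h2 := card_union_le ((range m).biUnion f ∪ Z) X
          have h3 := card_union_le ((range m).biUnion f) Z
          nlinarith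
        obtain ⟨e, he, hxm, hxm1, hdis⟩ := hS m hm hpm U hUc (by simp [hU]) (by simp [hU])
        have key : ∀ v ∈ e, v ∈ (range m).biUnion f ∪ Z ∪ X → v = x m ∨ v = x (m + 1) := by
          intro v hv hv'
          by_contra hne
          exact disjoint_left.1 hdis hv (mem_sdiff.2 ⟨hv', by simpa using hne⟩)
        refine ⟨e, ⟨he, hxm, hxm1, fun j hj hje => ?_, fun _ v hv => ?_,
          fun h => absurd h hpm⟩, fun i hi v hv => ?_⟩
        · rcases key _ hje (mem_union_right _ (hmX j hj)) with h | h
          · exact Or.inl (hx' _ _ hj (by omega) h)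
          · exact Or.inr (hx' _ _ hj (by omega) h)
        · obtain ⟨hv1, hv2⟩ := mem_inter.1 hv
          rcases key _ hv1 (mem_union_left _ (mem_union_right _ hv2)) with rfl | rfl
          · exact hmX _ (by omega)
          · exact hmX _ (by omega)
        · obtain ⟨hv1, hv2⟩ := mem_inter.1 hv
          rcases key _ hv2 (mem_union_left _ (mem_union_left _
            (mem_biUnion.2 ⟨i, mem_range.2 hi, hv1⟩))) with rfl | rfl
          · simp
          · have := (hQ i hi).2.2.2.1 (m + 1) (by omega) hv1
            omega)
  refine fun hfree => hfree ⟨fun i => A i, ⟨fun i => hH _ (hA i i.2).1, fun i j hij => ?_,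
    fun i j hij => ?_⟩, fun i => (hA i i.2).1⟩
  · have hi := hA i i.2
    have hj := hA j j.2
    have : A i ∩ A j = {x j} := by
      refine Subset.antisymm (hAA i j (by omega) j.2) ?_
      rw [singleton_subset_iff, mem_inter]
      exact ⟨hij ▸ hi.2.2.1, hj.2.1⟩
    simp [this]
  · have hi := hA i i.2
    rw [disjoint_left]
    intro v hv1 hv2
    have := hAA i j (by omega) j.2 (mem_inter.2 ⟨hv1, hv2⟩)
    rw [mem_singleton] at this
    subst this
    have := hi.2.2.2.1 j j.2.le hv1
    omega

section Counting

variable {n : ℕ}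

theorem card_filter_superset_disjoint (m : ℕ) (K W : Finset (Fin n)) (hKW : Disjoint K W)
    (hK : #K ≤ m) :
    #{T ∈ powersetCard m (univ : Finset (Fin n)) | K ⊆ T ∧ Disjoint T W} =
      (n - #K - #W).choose (m - #K) := by
  have hc : #((univ : Finset (Fin n)) \ (K ∪ W)) = n - #K - #W := by
    rw [card_sdiff_of_subset (subset_univ _), card_union_of_disjoint hKW, card_univ,
      Fintype.card_fin, Nat.sub_add_eq]
  rw [← hc, ← card_powersetCard]
  refine card_nbij' (· \ K) (· ∪ K) ?_ ?_ ?_ ?_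
  · intro T hT
    simp only [coe_filter, mem_powersetCard, subset_univ, true_and, Set.mem_ofPred_eq] at hT
    simp only [mem_coe, mem_powersetCard]
    refine ⟨fun v hv => ?_, by rw [card_sdiff_of_subset hT.2.1, hT.1]⟩
    obtain ⟨hv1, hv2⟩ := mem_sdiff.1 hv
    simpa [hv2] using disjoint_left.1 hT.2.2 hv1
  · intro T hT
    simp only [mem_coe, mem_powersetCard] at hT
    have hd : Disjoint T K := disjoint_left.2 fun v hv hvK => by
      simpa [hvK] using hT.1 hv
    simp only [coe_filter, mem_powersetCard, subset_univ, true_and, Set.mem_ofPred_eq]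
    refine ⟨by rw [card_union_of_disjoint hd, hT.2]; omega, subset_union_right, ?_⟩
    refine disjoint_union_left.2 ⟨disjoint_left.2 fun v hv hvW => ?_, hKW⟩
    simpa [hvW] using hT.1 hv
  · intro T hT
    simp only [coe_filter, Set.mem_ofPred_eq] at hT
    exact sdiff_union_of_subset hT.2.1
  · intro T hT
    simp only [mem_coe, mem_powersetCard] at hT
    have hd : Disjoint T K := disjoint_left.2 fun v hv hvK => by
      simpa [hvK] using hT.1 hv
    exact union_sdiff_cancel_right hd

theorem card_le_pow_of_superset {m : ℕ} {F : Finset (Finset (Fin n))} (K : Finset (Fin n))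
    (hF : ∀ T ∈ F, #T = m ∧ K ⊆ T) : #F ≤ n ^ (m - #K) := by
  rcases F.eq_empty_or_nonempty with rfl | ⟨T, hT⟩
  · simp
  have hK : #K ≤ m := (hF T hT).1 ▸ card_le_card (hF T hT).2
  calc #F ≤ #{T ∈ powersetCard m (univ : Finset (Fin n)) | K ⊆ T ∧ Disjoint T ∅} :=
        card_le_card fun T hT => by simpa using hF T hT
    _ = (n - #K).choose (m - #K) := by
        rw [card_filter_superset_disjoint m K ∅ (disjoint_empty_right _) hK]; simp
    _ ≤ (n - #K) ^ (m - #K) := Nat.choose_le_pow _ _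
    _ ≤ n ^ (m - #K) := Nat.pow_le_pow_left (Nat.sub_le _ _) _

theorem card_le_mul_pow_of_meets {m : ℕ} {F : Finset (Finset (Fin n))} (K Z : Finset (Fin n))
    (hF : ∀ T ∈ F, #T = m ∧ K ⊆ T ∧ ∃ z ∈ Z, z ∉ K ∧ z ∈ T) :
    #F ≤ #Z * n ^ (m - (#K + 1)) := by
  have hsub : F ⊆ Z.biUnion fun z => {T ∈ F | z ∉ K ∧ z ∈ T} := fun T hT => by
    obtain ⟨-, -, z, hz, h⟩ := hF T hT
    exact mem_biUnion.2 ⟨z, hz, mem_filter.2 ⟨hT, h⟩⟩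
  refine (card_le_card hsub).trans (card_biUnion_le.trans
    ((sum_le_card_nsmul _ _ (n ^ (m - (#K + 1))) fun z _ => ?_).trans (by simp)))
  by_cases hzK : z ∈ K
  · simp [hzK]
  · rw [← card_insert_of_notMem hzK]
    refine card_le_pow_of_superset (insert z K) fun T hT => ?_
    obtain ⟨hT, -, hz⟩ := mem_filter.1 hT
    exact ⟨(hF T hT).1, insert_subset hz (hF T hT).2.1⟩

theorem pow_le_mul_choose_sub (c m : ℕ) (hn : 2 * (c + m) ≤ n) :
    (n : ℝ) ^ m ≤ (2 ^ m * m.factorial : ℝ) * ((n - c).choose m : ℝ) := by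
  have h := Nat.pow_le_choose (α := ℝ) m (n - c)
  rw [div_le_iff₀ (by positivity)] at h
  have h2 : (n : ℝ) ≤ 2 * ((n - c + 1 - m : ℕ) : ℝ) := by
    exact_mod_cast (by omega : n ≤ 2 * (n - c + 1 - m))
  calc (n : ℝ) ^ m ≤ (2 * ((n - c + 1 - m : ℕ) : ℝ)) ^ m := by gcongr
    _ = 2 ^ m * ((n - c + 1 - m : ℕ) : ℝ) ^ m := mul_pow _ _ _
    _ ≤ 2 ^ m * (((n - c).choose m : ℝ) * m.factorial) := by gcongr
    _ = _ := by ring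

end Counting

/-- A linear-path-free family is at most a constant factor larger than its shadow. -/
theorem LinearPathFree.card_le_mul_shadow {n k M : ℕ} (hk : 2 ≤ k)
    {H F : Finset (Finset (Fin n))} (hH : ∀ e ∈ H, #e = k) (hfree : LinearPathFree k M H)
    (hFH : F ⊆ H) (B : Finset (Finset (Fin n))) (hB : ∀ e ∈ F, ∀ z ∈ e, e.erase z ∈ B) :
    (#F : ℝ) ≤ ((2 * (k + 1) * (M + 1) : ℕ) + 1) * #B := by
  set w := 2 * (k + 1) * (M + 1) with hw
  obtain ⟨F', hF', hcard, hfull⟩ := exists_full_subfamily F B (fun e T => T ⊆ e) ((w : ℝ) + 1)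
    (by positivity)
  rcases F'.eq_empty_or_nonempty with rfl | ⟨e₀, he₀⟩
  · simpa using hcard
  exfalso
  have hex : ∀ W : Finset (Fin n), #W ≤ w → ∀ e ∈ F', ∀ z ∈ e,
      #W < #{e' ∈ F' | e.erase z ⊆ e'} := by
    intro W hW e he z hz
    have := hfull e he _ (hB e (hF' he) z hz) (erase_subset _ _)
    have : w + 1 ≤ #{e' ∈ F' | e.erase z ⊆ e'} := by exact_mod_cast this
    omega
  have havoid : ∀ K W : Finset (Fin n), Disjoint K W → #W ≤ w → ∀ e ∈ F', K ⊆ e →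
      ∃ e' ∈ F', K ⊆ e' ∧ Disjoint e' W := fun K W hKW hW e he hKe =>
    exists_disjoint_of_exchange F' (fun e he => hH e (hFH (hF' he))) K W hKW
      (fun e he _ z hz _ => hex W hW e he z hz) he hKe
  have hstrong : ∀ e ∈ F', ∀ a ∈ e, ∀ b ∈ e, IsStrongPair H w a b := by
    intro e he a ha b hb W hW haW hbW
    obtain ⟨e', he', hsub, hd⟩ := havoid {a, b} W
      (by simp [haW, hbW]) hW e he (by simp [insert_subset_iff, ha, hb])
    exact ⟨e', hFH (hF' he'), hsub (by simp), hsub (by simp), hd⟩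
  have hcard' : ∀ e ∈ F', #e = k := fun e he => hH e (hFH (hF' he))
  obtain ⟨v₀, hv₀⟩ : e₀.Nonempty := card_pos.1 (by rw [hcard' e₀ he₀]; omega)
  have : Nonempty (Fin n) := ⟨v₀⟩
  obtain ⟨x, -, hx⟩ := exists_seq_of_greedy (M + 1) (fun _ v => ∃ e ∈ F', v ∈ e)
    (fun i j a b => a ≠ b ∧ (j = i + 1 → IsStrongPair H w a b)) (by
      intro m hm f hQ hR
      rcases m with _ | m
      · exact ⟨v₀, ⟨e₀, he₀, hv₀⟩, by simp⟩
      · obtain ⟨e, he, hve⟩ := hQ m (by omega)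
        obtain ⟨e', he', hsub, hd⟩ := havoid {f m} ((range m).image f) (by
            rw [disjoint_singleton_left]
            intro h
            obtain ⟨i, hi, hif⟩ := mem_image.1 h
            exact (hR i m (mem_range.1 hi) (by omega)).1 hif)
          (card_image_le.trans (by rw [card_range, hw]; nlinarith)) e he (by simpa using hve)
        have hme' : f m ∈ e' := hsub (by simp)
        obtain ⟨b, hb, hbm⟩ := exists_mem_ne (by rw [hcard' e' he']; omega) (f m)
        refine ⟨b, ⟨e', he', hb⟩, fun i hi => ?_⟩
        rcases eq_or_ne i m with rfl | hne
        · exact ⟨hbm.symm, fun _ => hstrong e' he' _ hme' _ hb⟩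
        · refine ⟨?_, by omega⟩
          rintro rfl
          exact disjoint_left.1 hd hb (mem_image_of_mem f (mem_range.2 (by omega))))
  exact not_linearPathFree_of_joints (w := w) hH x (fun i j hij hj => (hx i j hij (by omega)).1)
    (fun _ => False) (fun _ => ∅) (by simp) (by simp)
    (fun i hi _ => (hx i (i + 1) (by omega) (by omega)).2 rfl) (by omega) hfree

theorem not_linearPathFree_of_alternating {n k t w : ℕ} {H : Finset (Finset (Fin n))}
    (hH : ∀ e ∈ H, #e = k) (hw : 2 * (k + 1) * (2 * t + 2 + 1) ≤ w) (a y : ℕ → Fin n)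
    (ha : ∀ i j, i < j → j ≤ t → a i ≠ a j) (hy : ∀ i j, i < j → j ≤ t + 1 → y i ≠ y j)
    (hay : ∀ i ≤ t, ∀ j ≤ t + 1, a i ≠ y j)
    (hs : ∀ i ≤ t, IsStrongPair H w (y i) (a i) ∧ IsStrongPair H w (a i) (y (i + 1))) :
    ¬ LinearPathFree k (2 * t + 2) H := by
  set x : ℕ → Fin n := fun i => if i % 2 = 0 then y (i / 2) else a (i / 2) with hx
  have h0 : ∀ l, x (2 * l) = y l := fun l => by
    have : 2 * l % 2 = 0 := by omega
    have h2 : 2 * l / 2 = l := by omega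
    simp [hx]
  have h1 : ∀ l, x (2 * l + 1) = a l := fun l => by
    have : (2 * l + 1) % 2 = 1 := by omega
    have h2 : (2 * l + 1) / 2 = l := by omega
    simp [hx, this, h2]
  have hcases : ∀ i, (∃ l, i = 2 * l) ∨ ∃ l, i = 2 * l + 1 := fun i => by
    obtain ⟨l, hl | hl⟩ := Nat.even_or_odd' i
    exacts [Or.inl ⟨l, hl⟩, Or.inr ⟨l, hl⟩]
  refine not_linearPathFree_of_joints (w := w) hH x ?_ (fun _ => False) (fun _ => ∅) (by simp)
    (by simp) ?_ hw
  · intro i j hij hj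
    rcases hcases i with ⟨l, rfl⟩ | ⟨l, rfl⟩ <;> rcases hcases j with ⟨l', rfl⟩ | ⟨l', rfl⟩ <;>
      simp only [h0, h1]
    · exact hy _ _ (by omega) (by omega)
    · exact (hay _ (by omega) _ (by omega)).symm
    · exact hay _ (by omega) _ (by omega)
    · exact ha _ _ (by omega) (by omega)
  · intro i hi _
    rcases hcases i with ⟨l, rfl⟩ | ⟨l, rfl⟩
    · rw [h0, h1]
      exact (hs l (by omega)).1
    · rw [h1, show 2 * l + 1 + 1 = 2 * (l + 1) by ring, h0]
      exact (hs l (by omega)).2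

theorem not_linearPathFree_of_two_edges {n k t w : ℕ} {H : Finset (Finset (Fin n))}
    (hH : ∀ e ∈ H, #e = k) (hw : 2 * (k + 1) * (2 * t + 2 + 1) ≤ w)
    {A X E₀ E₁ : Finset (Fin n)} {v₀ v₁ v₂ : Fin n} (hA : #A = t) (hAX : Disjoint A X)
    (hs : ∀ u ∈ X, ∀ a ∈ A, IsStrongPair H w u a) (hX : w < #X)
    (hE₀ : E₀ ∈ H) (hE₁ : E₁ ∈ H) (hAE₀ : Disjoint A E₀) (hAE₁ : Disjoint A E₁)
    (hEE : E₀ ∩ E₁ = {v₁}) (h₀ : v₀ ∈ E₀) (h₀₁ : v₀ ≠ v₁) (h₂ : v₂ ∈ E₁) (h₁₂ : v₂ ≠ v₁)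
    (h₂X : v₂ ∈ X) : ¬ LinearPathFree k (2 * t + 2) H := by
  have : Nonempty (Fin n) := ⟨v₀⟩
  have h₁ : v₁ ∈ E₀ ∧ v₁ ∈ E₁ := mem_inter.1 (hEE ▸ mem_singleton_self v₁)
  have hmeet : ∀ v, v ∈ E₀ → v ∈ E₁ → v = v₁ := fun v h h' =>
    mem_singleton.1 (hEE ▸ mem_inter.2 ⟨h, h'⟩)
  obtain ⟨a, haA, ha⟩ := A.exists_injective_seq
  rw [hA] at haA ha
  obtain ⟨y, hyX, hy⟩ := exists_injective_seq t (fun v => v ∈ X ∧ v ∉ E₀ ∧ v ∉ E₁) (by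
    intro W hW
    have h1 := card_union_le W (E₀ ∪ E₁)
    have h2 := card_union_le E₀ E₁
    rw [hH _ hE₀, hH _ hE₁] at h2
    have h3 : t + 2 * k ≤ 2 * (k + 1) * (2 * t + 2 + 1) := by nlinarith
    obtain ⟨v, hv, hvn⟩ := exists_mem_notMem_of_card_lt_card
      (show #(W ∪ (E₀ ∪ E₁)) < #X by omega)
    simp only [mem_union, not_or] at hvn
    exact ⟨v, hvn.1, hv, hvn.2.1, hvn.2.2⟩)
  have hAX' : ∀ l < t, ∀ v ∈ X, a l ≠ v := fun l hl v hv h =>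
    disjoint_left.1 hAX (haA l hl) (h ▸ hv)
  have haE₀ : ∀ l < t, a l ∉ E₀ := fun l hl => disjoint_left.1 hAE₀ (haA l hl)
  have haE₁ : ∀ l < t, a l ∉ E₁ := fun l hl => disjoint_left.1 hAE₁ (haA l hl)
  set x : ℕ → Fin n := fun i => match i with
    | 0 => v₀
    | 1 => v₁
    | 2 => v₂
    | i + 3 => if i % 2 = 0 then a (i / 2) else y (i / 2) with hx
  have hx3 : ∀ l, x (2 * l + 3) = a l := fun l => by
    have h2 : 2 * l / 2 = l := by omega
    simp [hx]
  have hx4 : ∀ l, x (2 * l + 4) = y l := fun l => by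
    have h1 : (2 * l + 1) % 2 = 1 := by omega
    have h2 : (2 * l + 1) / 2 = l := by omega
    simp [hx, h1, h2]
  have hx0 : x 0 = v₀ := rfl
  have hx1 : x 1 = v₁ := rfl
  have hx2 : x 2 = v₂ := rfl
  have hcases : ∀ i, i = 0 ∨ i = 1 ∨ i = 2 ∨ (∃ l, i = 2 * l + 3) ∨ ∃ l, i = 2 * l + 4 := by
    intro i
    by_cases h : i < 3
    · omega
    · obtain ⟨l, hl | hl⟩ := Nat.even_or_odd' (i - 3)
      · exact Or.inr (Or.inr (Or.inr (Or.inl ⟨l, by omega⟩)))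
      · exact Or.inr (Or.inr (Or.inr (Or.inr ⟨l, by omega⟩)))
  refine not_linearPathFree_of_joints (w := w) hH x ?_ (fun i => i < 2)
    (fun i => if i = 0 then E₀ else E₁) ?_ ?_ ?_ hw
  · intro i j hij hj
    rcases hcases i with rfl | rfl | rfl | ⟨l, rfl⟩ | ⟨l, rfl⟩ <;>
      rcases hcases j with rfl | rfl | rfl | ⟨l', rfl⟩ | ⟨l', rfl⟩ <;>
      first
        | (exfalso; omega)
        | (simp only [hx0, hx1, hx2, hx3, hx4]; intro heq)
    · exact h₀₁ heq
    · exact h₀₁ (hmeet _ h₀ (heq ▸ h₂))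
    · exact haE₀ l' (by omega) (heq ▸ h₀)
    · exact (hyX l' (by omega)).2.1 (heq ▸ h₀)
    · exact h₁₂ heq.symm
    · exact haE₀ l' (by omega) (heq ▸ h₁.1)
    · exact (hyX l' (by omega)).2.1 (heq ▸ h₁.1)
    · exact haE₁ l' (by omega) (heq ▸ h₂)
    · exact (hyX l' (by omega)).2.2 (heq ▸ h₂)
    · exact ha l l' (by omega) (by omega) heq
    · exact hAX' l (by omega) _ (hyX l' (by omega)).1 heq
    · exact hAX' l' (by omega) _ (hyX l (by omega)).1 heq.symm
    · exact hy l l' (by omega) (by omega) heq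
  · intro i _ hi
    obtain rfl | rfl : i = 0 ∨ i = 1 := by omega
    · refine ⟨hE₀, h₀, h₁.1, fun j hj hje => ?_⟩
      simp only [if_true] at hje
      rcases hcases j with rfl | rfl | rfl | ⟨l, rfl⟩ | ⟨l, rfl⟩
      · omega
      · omega
      · exact absurd (hmeet _ hje h₂) h₁₂
      · exact absurd (hx3 l ▸ hje) (haE₀ l (by omega))
      · exact absurd (hx4 l ▸ hje) (hyX l (by omega)).2.1
    · refine ⟨hE₁, h₁.2, h₂, fun j hj hje => ?_⟩
      simp only [one_ne_zero, if_false] at hje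
      rcases hcases j with rfl | rfl | rfl | ⟨l, rfl⟩ | ⟨l, rfl⟩
      · exact absurd (hmeet _ h₀ hje) h₀₁
      · omega
      · omega
      · exact absurd (hx3 l ▸ hje) (haE₁ l (by omega))
      · exact absurd (hx4 l ▸ hje) (hyX l (by omega)).2.2
  · intro i j hij _ hi hj
    obtain rfl : i = 0 := by omega
    obtain rfl : j = 1 := by omega
    simp [hEE, hx1]
  · intro i hi hi2
    rcases hcases i with rfl | rfl | rfl | ⟨l, rfl⟩ | ⟨l, rfl⟩
    · omega
    · omega
    · exact hs _ h₂X _ (haA 0 (by omega))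
    · rw [hx3, show 2 * l + 3 + 1 = 2 * l + 4 by ring, hx4]
      exact (hs _ (hyX l (by omega)).1 _ (haA l (by omega))).symm
    · rw [hx4, show 2 * l + 4 + 1 = 2 * (l + 1) + 3 by ring, hx3]
      exact hs _ (hyX l (by omega)).1 _ (haA (l + 1) (by omega))

theorem not_linearPathFree_of_disjoint_edges {n k t w : ℕ} {H : Finset (Finset (Fin n))}
    (hk : 2 ≤ k) (ht : 1 ≤ t)
    (hH : ∀ e ∈ H, #e = k) (hw : 2 * (k + 1) * (2 * t + 2 + 1) ≤ w)
    {A X E E' : Finset (Fin n)} {u u' : Fin n} (hA : #A = t) (hAX : Disjoint A X)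
    (hs : ∀ u ∈ X, ∀ a ∈ A, IsStrongPair H w u a) (hX : w < #X)
    (hE : E ∈ H) (hE' : E' ∈ H) (hAE : Disjoint A E) (hAE' : Disjoint A E')
    (hEE : Disjoint E E') (hu : u ∈ E) (huX : u ∈ X) (hu' : u' ∈ E') (hu'X : u' ∈ X) :
    ¬ LinearPathFree k (2 * t + 2) H := by
  have : Nonempty (Fin n) := ⟨u⟩
  have hmeet : ∀ v, v ∈ E → v ∈ E' → False := fun v h h' => disjoint_left.1 hEE h h'
  obtain ⟨v, hv, hvu⟩ := exists_mem_ne (by rw [hH _ hE]; omega) u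
  obtain ⟨v', hv', hvu'⟩ := exists_mem_ne (by rw [hH _ hE']; omega) u'
  obtain ⟨a, haA, ha⟩ := A.exists_injective_seq
  rw [hA] at haA ha
  obtain ⟨z, hzX, hz⟩ := exists_injective_seq t (fun v => v ∈ X ∧ v ∉ E ∧ v ∉ E') (by
    intro W hW
    have h1 := card_union_le W (E ∪ E')
    have h2 := card_union_le E E'
    rw [hH _ hE, hH _ hE'] at h2
    have h3 : t + 2 * k ≤ 2 * (k + 1) * (2 * t + 2 + 1) := by nlinarith
    obtain ⟨v, hv, hvn⟩ := exists_mem_notMem_of_card_lt_card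
      (show #(W ∪ (E ∪ E')) < #X by omega)
    simp only [mem_union, not_or] at hvn
    exact ⟨v, hvn.1, hv, hvn.2.1, hvn.2.2⟩)
  have hAX' : ∀ l < t, ∀ v ∈ X, a l ≠ v := fun l hl v hv h =>
    disjoint_left.1 hAX (haA l hl) (h ▸ hv)
  have haE : ∀ l < t, a l ∉ E := fun l hl => disjoint_left.1 hAE (haA l hl)
  have haE' : ∀ l < t, a l ∉ E' := fun l hl => disjoint_left.1 hAE' (haA l hl)
  set y : ℕ → Fin n := fun l => if l = 0 then u else if l = t then u' else z l with hy
  have hy0 : y 0 = u := by simp [hy]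
  have hyt : y t = u' := by simp [hy, show t ≠ 0 by omega]
  have hyz : ∀ l, l ≠ 0 → l ≠ t → y l = z l := fun l h h' => by simp [hy, h, h']
  have hyX : ∀ l ≤ t, y l ∈ X := by
    intro l hl
    rcases eq_or_ne l 0 with rfl | h0
    · rwa [hy0]
    rcases eq_or_ne l t with rfl | h1
    · rwa [hyt]
    rw [hyz l h0 h1]
    exact (hzX l (by omega)).1
  have hyE : ∀ l ≤ t, y l ∈ E → l = 0 := by
    intro l hl hlE
    by_contra h0
    rcases eq_or_ne l t with rfl | h1
    · exact hmeet _ (hyt ▸ hlE) hu'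
    · exact (hzX l (by omega)).2.1 (hyz l h0 h1 ▸ hlE)
  have hyE' : ∀ l ≤ t, y l ∈ E' → l = t := by
    intro l hl hlE
    by_contra h1
    rcases eq_or_ne l 0 with rfl | h0
    · exact hmeet _ hu (hy0 ▸ hlE)
    · exact (hzX l (by omega)).2.2 (hyz l h0 h1 ▸ hlE)
  have hyinj : ∀ i j, i < j → j ≤ t → y i ≠ y j := by
    intro i j hij hj heq
    rcases eq_or_ne i 0 with rfl | h0
    · have := hyE j hj (by rw [← heq, hy0]; exact hu)
      omega
    rcases eq_or_ne j t with rfl | h1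
    · have := hyE' i (by omega) (by rw [heq, hyt]; exact hu')
      omega
    rw [hyz i h0 (by omega), hyz j (by omega) h1] at heq
    exact hz i j hij (by omega) heq
  set x : ℕ → Fin n := fun i => if i = 0 then v else if i = 2 * t + 2 then v' else
    if i % 2 = 1 then y (i / 2) else a (i / 2 - 1) with hx
  have hx0 : x 0 = v := by simp [hx]
  have hxM : x (2 * t + 2) = v' := by simp [hx]
  have hxy : ∀ l, x (2 * l + 1) = y l := fun l => by
    have h1 : (2 * l + 1) % 2 = 1 := by omega
    have h2 : (2 * l + 1) / 2 = l := by omega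
    have h3 : 2 * l + 1 ≠ 2 * t + 2 := by omega
    simp only [hx, h1, h2, h3, if_false, if_true]
    simp
  have hxa : ∀ l < t, x (2 * l + 2) = a l := fun l hl => by
    have h1 : (2 * l + 2) % 2 = 0 := by omega
    have h2 : (2 * l + 2) / 2 - 1 = l := by omega
    have h3 : 2 * l + 2 ≠ 2 * t + 2 := by omega
    simp only [hx, h1, h2, h3, if_false]
    simp
  have hcases : ∀ i ≤ 2 * t + 2, i = 0 ∨ i = 2 * t + 2 ∨ (∃ l ≤ t, i = 2 * l + 1) ∨
      ∃ l < t, i = 2 * l + 2 := by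
    intro i hi
    obtain ⟨l, hl | hl⟩ := Nat.even_or_odd' i
    · by_cases h : i = 0 ∨ i = 2 * t + 2
      · omega
      · exact Or.inr (Or.inr (Or.inr ⟨l - 1, by omega, by omega⟩))
    · exact Or.inr (Or.inr (Or.inl ⟨l, by omega, hl⟩))
  refine not_linearPathFree_of_joints (w := w) hH x ?_ (fun i => i = 0 ∨ i = 2 * t + 1)
    (fun i => if i = 0 then E else E') ?_ ?_ ?_ hw
  · intro i j hij hj
    rcases hcases i (by omega) with rfl | rfl | ⟨l, hl, rfl⟩ | ⟨l, hl, rfl⟩ <;>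
      rcases hcases j hj with rfl | rfl | ⟨l', hl', rfl⟩ | ⟨l', hl', rfl⟩ <;>
      first
        | (exfalso; omega)
        | (intro heq; try simp only [hx0, hxM, hxy] at heq)
    · exact hmeet _ hv (heq ▸ hv')
    · have := hyE l' hl' (heq ▸ hv)
      subst this
      exact hvu (heq.trans hy0)
    · exact haE l' hl' (by rw [← hxa l' hl', ← heq]; exact hv)
    · have := hyE' l hl (heq ▸ hv')
      subst this
      exact hvu' (heq.symm.trans hyt)
    · exact hyinj l l' (by omega) hl' heq
    · exact hAX' l' hl' _ (hyX l hl) (by rw [heq, hxa l' hl'])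
    · exact haE' l hl (by rw [← hxa l hl, heq]; exact hv')
    · exact hAX' l hl _ (hyX l' hl') (by rw [← heq, hxa l hl])
    · exact ha l l' (by omega) hl' (by rw [← hxa l hl, ← hxa l' hl', heq])
  · intro i _ hi
    rcases hi with rfl | rfl
    · refine ⟨hE, by simpa [hx0] using hv, ?_, fun j hj hje => ?_⟩
      · have := hxy 0
        simp only [mul_zero, zero_add] at this
        simpa [this, hy0] using hu
      simp only [if_true] at hje
      rcases hcases j hj with rfl | rfl | ⟨l, hl, rfl⟩ | ⟨l, hl, rfl⟩
      · omega
      · exact absurd (hxM ▸ hv') fun h => hmeet _ hje h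
      · have := hyE l hl (hxy l ▸ hje)
        omega
      · exact absurd (hxa l hl ▸ hje) (haE l hl)
    · have h0 : 2 * t + 1 ≠ 0 := by omega
      simp only [h0, if_false]
      refine ⟨hE', by rw [hxy, hyt]; exact hu', ?_, fun j hj hje => ?_⟩
      · rw [show 2 * t + 1 + 1 = 2 * t + 2 by ring, hxM]
        exact hv'
      rcases hcases j hj with rfl | rfl | ⟨l, hl, rfl⟩ | ⟨l, hl, rfl⟩
      · exact absurd (hx0 ▸ hv) fun h => hmeet _ h hje
      · omega
      · have := hyE' l hl (hxy l ▸ hje)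
        omega
      · exact absurd (hxa l hl ▸ hje) (haE' l hl)
  · intro i j hij _ hi hj
    obtain rfl : i = 0 := by omega
    have hj0 : j ≠ 0 := by omega
    simp [hj0, disjoint_iff_inter_eq_empty.1 hEE]
  · intro i hi hi2
    rcases hcases i hi.le with rfl | rfl | ⟨l, hl, rfl⟩ | ⟨l, hl, rfl⟩
    · simp at hi2
    · omega
    · have hlt : l < t := by omega
      rw [hxy, hxa l hlt]
      exact hs _ (hyX l hl) _ (haA l hlt)
    · rw [hxa l hl, show 2 * l + 2 + 1 = 2 * (l + 1) + 1 by ring, hxy]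
      exact (hs _ (hyX (l + 1) (by omega)) _ (haA l hl)).symm

/-- In a uniform family of large minimum degree whose members carry lists, no colour of which is
popular, there is a long loose path such that nonconsecutive members have disjoint lists. -/
theorem exists_path_of_light_lists {n m r s : ℕ} {γ η : ℝ} (hη : 0 < η)
    {G : Finset (Finset (Fin n))} (L : Finset (Fin n) → Finset (Fin n)) (hG : ∀ T ∈ G, #T = m + 2)
    (hne : G.Nonempty) (hL : ∀ T ∈ G, #(L T) ≤ s)
    (hdeg : ∀ T ∈ G, ∀ u ∈ T, γ * n ^ (m + 1) ≤ #{T' ∈ G | u ∈ T'})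
    (hlight : ∀ v, (#{T ∈ G | v ∈ L T} : ℝ) ≤ η ^ 2 / (m + 2) * n ^ (m + 2))
    (hγ : 4 * r * s * η ≤ γ) (hn : 2 * r * (m + 2) < γ * n) :
    ∃ (T : ℕ → Finset (Fin n)) (u : ℕ → Fin n),
      (∀ i < r, T i ∈ G ∧ u i ∈ T i ∧ u (i + 1) ∈ T i) ∧
      (∀ i j, i < j → j ≤ r → u i ≠ u j) ∧
      (∀ i < r, ∀ j ≤ r, u j ∈ T i → j = i ∨ j = i + 1) ∧
      ∀ i j, i < j → j < r → T i ∩ T j ⊆ {u j} ∧ (i + 1 < j → Disjoint (L (T i)) (L (T j))) := by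
  obtain ⟨T₀, hT₀⟩ := hne
  obtain ⟨u₀, hu₀⟩ : T₀.Nonempty := card_pos.1 (by rw [hG _ hT₀]; omega)
  have hn0 : (0 : ℝ) < n := by
    have : 0 < n := u₀.pos
    exact_mod_cast this
  have : Nonempty (Fin n × Finset (Fin n) × Fin n) := ⟨(u₀, ∅, u₀)⟩
  set D : Fin n → Finset (Fin n) := fun v =>
    {u | η * n ^ (m + 1) < (#{T ∈ G | u ∈ T ∧ v ∈ L T} : ℝ)} with hD
  have hDc : ∀ v, (#(D v) : ℝ) ≤ η * n := by
    intro v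
    have h1 : ∑ u : Fin n, #{T ∈ G | u ∈ T ∧ v ∈ L T} = (m + 2) * #{T ∈ G | v ∈ L T} := by
      have := sum_card_bipartiteAbove_eq_sum_card_bipartiteBelow
        (s := (univ : Finset (Fin n))) (t := {T ∈ G | v ∈ L T}) (fun u T => u ∈ T)
      simp only [bipartiteAbove, bipartiteBelow, filter_filter] at this
      simp_rw [and_comm (b := v ∈ L _)]
      rw [this, mul_comm, ← smul_eq_mul, ← sum_const]
      refine sum_congr rfl fun T hT => ?_
      rw [filter_univ_mem, hG _ (mem_filter.1 hT).1]
    have h2 : (#(D v) : ℝ) * (η * n ^ (m + 1)) ≤ (m + 2) * #{T ∈ G | v ∈ L T} := by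
      calc (#(D v) : ℝ) * (η * n ^ (m + 1))
          ≤ ∑ u ∈ D v, (#{T ∈ G | u ∈ T ∧ v ∈ L T} : ℝ) := by
            rw [← nsmul_eq_mul]
            exact card_nsmul_le_sum _ _ _ fun u hu => (mem_filter.1 hu).2.le
        _ ≤ ∑ u : Fin n, (#{T ∈ G | u ∈ T ∧ v ∈ L T} : ℝ) :=
            sum_le_univ_sum_of_nonneg fun _ => Nat.cast_nonneg _
        _ = _ := by exact_mod_cast h1
    have h3 : (m + 2 : ℝ) * #{T ∈ G | v ∈ L T} ≤ η ^ 2 * n ^ (m + 2) := by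
      calc (m + 2 : ℝ) * #{T ∈ G | v ∈ L T} ≤ (m + 2) * (η ^ 2 / (m + 2) * n ^ (m + 2)) := by
            gcongr; exact hlight v
        _ = _ := by field_simp
    have h4 : (#(D v) : ℝ) * (η * n ^ (m + 1)) ≤ (η * n) * (η * n ^ (m + 1)) := by
      calc _ ≤ _ := h2.trans h3
        _ = _ := by ring
    exact le_of_mul_le_mul_right h4 (by positivity)
  obtain ⟨f, hQ, hR⟩ := exists_seq_of_greedy r
    (fun _ (p : Fin n × Finset (Fin n) × Fin n) =>
      p.2.1 ∈ G ∧ p.1 ∈ p.2.1 ∧ p.2.2 ∈ p.2.1 ∧ p.1 ≠ p.2.2)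
    (fun i j p q => p.2.1 ∩ q.2.1 ⊆ {q.1} ∧ (j = i + 1 → q.1 = p.2.2) ∧
      (i + 1 < j → Disjoint (L p.2.1) (L q.2.1)) ∧ q.2.2 ∉ p.2.1 ∧
      ∀ v ∈ L p.2.1, q.2.2 ∉ D v) (by
    intro l hl f hQ hR
    obtain ⟨a, ha, hala⟩ : ∃ a, (∃ T ∈ G, a ∈ T) ∧ (∀ i < l, l = i + 1 → a = (f i).2.2) := by
      rcases l with _ | l
      · exact ⟨u₀, ⟨T₀, hT₀, hu₀⟩, by simp⟩
      · refine ⟨(f l).2.2, ⟨_, (hQ l (by omega)).1, (hQ l (by omega)).2.2.1⟩, ?_⟩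
        intro i _ hi
        rw [show i = l by omega]
    have haD : ∀ i, i + 1 < l → ∀ v ∈ L (f i).2.1, a ∉ D v := by
      intro i hi v hv
      rw [hala (l - 1) (by omega) (by omega)]
      exact (hR i (l - 1) (by omega) (by omega)).2.2.2.2 v hv
    set Λ : Finset (Fin n) := (range l).biUnion fun i => L (f i).2.1 with hΛ
    have hΛc : #Λ ≤ r * s := by
      refine card_biUnion_le.trans ((sum_le_card_nsmul _ _ s fun i hi =>
        hL _ (hQ i (mem_range.1 hi)).1).trans ?_)
      simpa using Nat.mul_le_mul_right s hl.le
    set Λ' : Finset (Fin n) := {v ∈ Λ | a ∉ D v} with hΛ'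
    set Z : Finset (Fin n) := ((range l).biUnion fun i => (f i).2.1) ∪ Λ.biUnion D with hZ
    have hZc : (#Z : ℝ) ≤ r * (m + 2) + r * s * (η * n) := by
      have h1 : #((range l).biUnion fun i => (f i).2.1) ≤ r * (m + 2) := by
        refine card_biUnion_le.trans ((sum_le_card_nsmul _ _ (m + 2) fun i hi =>
          (hG _ (hQ i (mem_range.1 hi)).1).le).trans ?_)
        simpa using Nat.mul_le_mul_right (m + 2) hl.le
      have h2 : (#(Λ.biUnion D) : ℝ) ≤ r * s * (η * n) := by
        calc (#(Λ.biUnion D) : ℝ) ≤ ∑ v ∈ Λ, (#(D v) : ℝ) := by exact_mod_cast card_biUnion_le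
          _ ≤ #Λ • (η * n) := sum_le_card_nsmul _ _ _ fun v _ => hDc v
          _ ≤ _ := by
            rw [nsmul_eq_mul]
            gcongr
            exact_mod_cast hΛc
      have h3 : (#Z : ℝ) ≤ #((range l).biUnion fun i => (f i).2.1) + #(Λ.biUnion D) := by
        exact_mod_cast card_union_le _ _
      have h1' : (#((range l).biUnion fun i => (f i).2.1) : ℝ) ≤ r * (m + 2) := by
        exact_mod_cast h1
      linarith
    obtain ⟨T, hTG, haT, hTZ, hTΛ⟩ : ∃ T ∈ G, a ∈ T ∧ (∀ z ∈ Z, z ≠ a → z ∉ T) ∧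
        ∀ v ∈ Λ', v ∉ L T := by
      by_contra! hcon
      have hsub : {T ∈ G | a ∈ T} ⊆ {T ∈ G | a ∈ T ∧ ∃ z ∈ Z, z ≠ a ∧ z ∈ T} ∪
          Λ'.biUnion fun v => {T ∈ G | a ∈ T ∧ v ∈ L T} := by
        intro T hT
        obtain ⟨hTG, haT⟩ := mem_filter.1 hT
        by_cases h : ∃ z ∈ Z, z ≠ a ∧ z ∈ T
        · exact mem_union_left _ (mem_filter.2 ⟨hTG, haT, h⟩)
        · push Not at h
          obtain ⟨v, hv, hvL⟩ := hcon T hTG haT h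
          exact mem_union_right _ (mem_biUnion.2 ⟨v, hv, mem_filter.2 ⟨hTG, haT, hvL⟩⟩)
      have h1 : (#{T ∈ G | a ∈ T ∧ ∃ z ∈ Z, z ≠ a ∧ z ∈ T} : ℝ) ≤ #Z * n ^ m := by
        have := card_le_mul_pow_of_meets (m := m + 2)
          (F := {T ∈ G | a ∈ T ∧ ∃ z ∈ Z, z ≠ a ∧ z ∈ T}) {a} Z (fun T hT => by
            obtain ⟨hT, haT, z, hz, hza, hzT⟩ := mem_filter.1 hT
            exact ⟨hG T hT, by simpa using haT, z, hz, by simpa using hza, hzT⟩)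
        simp only [card_singleton, Nat.add_sub_cancel] at this
        exact_mod_cast this
      have h2 : (#(Λ'.biUnion fun v => {T ∈ G | a ∈ T ∧ v ∈ L T}) : ℝ) ≤
          r * s * (η * n ^ (m + 1)) := by
        calc (#(Λ'.biUnion fun v => {T ∈ G | a ∈ T ∧ v ∈ L T}) : ℝ)
            ≤ ∑ v ∈ Λ', (#{T ∈ G | a ∈ T ∧ v ∈ L T} : ℝ) := by exact_mod_cast card_biUnion_le
          _ ≤ #Λ' • (η * n ^ (m + 1)) := sum_le_card_nsmul _ _ _ fun v hv => by
              have := (mem_filter.1 hv).2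
              simpa [hD] using this
          _ ≤ _ := by
            rw [nsmul_eq_mul]
            gcongr
            exact_mod_cast (card_filter_le _ _).trans hΛc
      have h3 : (#{T ∈ G | a ∈ T} : ℝ) ≤ #{T ∈ G | a ∈ T ∧ ∃ z ∈ Z, z ≠ a ∧ z ∈ T} +
          #(Λ'.biUnion fun v => {T ∈ G | a ∈ T ∧ v ∈ L T}) := by
        exact_mod_cast (card_le_card hsub).trans (card_union_le _ _)
      obtain ⟨T₁, hT₁, haT₁⟩ := ha
      have h4 := hdeg T₁ hT₁ a haT₁
      have h5 : (#Z : ℝ) * n ^ m ≤ (r * (m + 2) + r * s * (η * n)) * n ^ m := by gcongr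
      have h6 : γ * n ^ (m + 1) ≤ (r * (m + 2) + 2 * (r * s * (η * n))) * n ^ m := by
        calc γ * n ^ (m + 1) ≤ (r * (m + 2) + r * s * (η * n)) * n ^ m +
              r * s * (η * n ^ (m + 1)) := by linarith
          _ = _ := by ring
      have h7 : γ * n ≤ r * (m + 2) + 2 * (r * s * (η * n)) := by
        refine le_of_mul_le_mul_right (a := (n : ℝ) ^ m) ?_ (by positivity)
        calc γ * n * n ^ m = γ * n ^ (m + 1) := by ring
          _ ≤ _ := h6
      have h8 : 4 * r * s * η * n ≤ γ * n := by gcongr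
      nlinarith
    obtain ⟨b, hbT, hba⟩ := exists_mem_ne (by rw [hG T hTG]; omega : 1 < #T) a
    have hbZ : b ∉ Z := fun h => hTZ b h hba hbT
    refine ⟨(a, T, b), ⟨hTG, haT, hbT, hba.symm⟩, fun i hi => ⟨fun v hv => ?_, hala i hi, ?_,
      ?_, ?_⟩⟩
    · obtain ⟨hv1, hv2⟩ := mem_inter.1 hv
      by_contra hva
      exact hTZ v (mem_union_left _ (mem_biUnion.2 ⟨i, mem_range.2 hi, hv1⟩)) (by simpa using hva)
        hv2
    · intro hil
      refine disjoint_left.2 fun v hv hvT => hTΛ v (mem_filter.2 ⟨?_, haD i hil v hv⟩) hvT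
      exact mem_biUnion.2 ⟨i, mem_range.2 hi, hv⟩
    · exact fun h => hbZ (mem_union_left _ (mem_biUnion.2 ⟨i, mem_range.2 hi, h⟩))
    · exact fun v hv h => hbZ (mem_union_right _ (mem_biUnion.2
        ⟨v, mem_biUnion.2 ⟨i, mem_range.2 hi, hv⟩, h⟩)))
  set u : ℕ → Fin n := fun j => if j = r then (if r = 0 then u₀ else (f (r - 1)).2.2)
    else (f j).1 with hu
  have hu1 : ∀ j < r, u j = (f j).1 := fun j hj => by simp [hu, hj.ne]
  have hu2 : ∀ j < r, u (j + 1) = (f j).2.2 := by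
    intro j hj
    by_cases h : j + 1 = r
    · have : r ≠ 0 := by omega
      simp [hu, h, this, show r - 1 = j by omega]
    · rw [hu1 _ (by omega)]
      exact (hR j (j + 1) (by omega) (by omega)).2.1 rfl
  have hback : ∀ i j, i + 1 < j → j ≤ r → u j ∉ (f i).2.1 := by
    intro i j hij hj
    obtain ⟨j, rfl⟩ : ∃ j', j = j' + 1 := ⟨j - 1, by omega⟩
    rw [hu2 j (by omega)]
    exact (hR i j (by omega) (by omega)).2.2.2.1
  have hinj : ∀ i j, i < j → j ≤ r → u i ≠ u j := by
    intro i j hij hj h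
    rcases Nat.lt_or_ge (i + 1) j with h1 | h1
    · refine hback i j h1 hj ?_
      rw [← h, hu1 i (by omega)]
      exact (hQ i (by omega)).2.1
    · obtain rfl : j = i + 1 := by omega
      rw [hu1 i (by omega), hu2 i (by omega)] at h
      exact (hQ i (by omega)).2.2.2 h
  refine ⟨fun i => (f i).2.1, u, fun i hi => ?_, hinj, ?_, fun i j hij hj => ?_⟩
  · obtain ⟨h1, h2, h3, -⟩ := hQ i hi
    exact ⟨h1, by rwa [hu1 i hi], by rwa [hu2 i hi]⟩
  · intro i hi j hj h
    rcases lt_trichotomy i j with h1 | h1 | h1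
    · by_contra hne
      exact hback i j (by omega) hj h
    · exact Or.inl h1.symm
    · rw [hu1 j (by omega)] at h
      have h2 := (hR j i h1 hi).1 (mem_inter.2 ⟨(hQ j (by omega)).2.1, h⟩)
      rw [mem_singleton, ← hu1 i hi, ← hu1 j (by omega)] at h2
      exact absurd h2 (hinj j i h1 (by omega))
  · obtain ⟨h1, -, h3, -⟩ := hR i j hij hj
    exact ⟨by rwa [hu1 j hj], h3⟩

/-- Some vertex bipartition separates a positive proportion of the members of a family from the
lists they carry. -/
theorem exists_separating_set {V : Type*} [Fintype V] [DecidableEq V] (𝒯 : Finset (Finset V))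
    (L : Finset V → Finset V) (c : ℕ) (hd : ∀ T ∈ 𝒯, Disjoint (L T) T)
    (hc : ∀ T ∈ 𝒯, #(L T) + #T = c) :
    ∃ Y : Finset V, #𝒯 ≤ 2 ^ c * #{T ∈ 𝒯 | L T ⊆ Y ∧ Disjoint T Y} := by
  obtain ⟨Y, -, hY⟩ := exists_le_of_sum_le (s := (univ : Finset (Finset V)))
    (f := fun _ => #𝒯) (g := fun Y => 2 ^ c * #{T ∈ 𝒯 | L T ⊆ Y ∧ Disjoint T Y})
    univ_nonempty (by
      have h1 := sum_card_bipartiteAbove_eq_sum_card_bipartiteBelow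
        (s := (univ : Finset (Finset V))) (t := 𝒯) (fun Y T => L T ⊆ Y ∧ Disjoint T Y)
      simp only [bipartiteAbove, bipartiteBelow] at h1
      rw [← mul_sum, h1, mul_sum, sum_const, card_univ, Fintype.card_finset, smul_eq_mul,
        mul_comm, ← smul_eq_mul, ← sum_const]
      refine sum_le_sum fun T hT => ?_
      have h2 : ({Y | L T ⊆ Y ∧ Disjoint T Y} : Finset (Finset V)) = Icc (L T) Tᶜ := by
        ext Y
        simp only [mem_filter, mem_univ, true_and, mem_Icc, subset_compl_iff_disjoint_left]
      have h3 : L T ⊆ Tᶜ := subset_compl_iff_disjoint_right.2 (hd T hT)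
      rw [h2, card_Icc_finset h3, card_compl, ← pow_add, ← hc T hT]
      refine Nat.pow_le_pow_right (by omega) ?_
      omega)
  exact ⟨Y, hY⟩

/-- A dense uniform family has a nonempty subfamily of large minimum degree. -/
theorem exists_subfamily_min_degree {n m : ℕ} {δ : ℝ} (hδ : 0 < δ) (hn : 0 < n)
    (G₀ : Finset (Finset (Fin n))) (hG₀ : δ * n ^ (m + 2) ≤ #G₀) :
    ∃ G ⊆ G₀, G.Nonempty ∧ ∀ T ∈ G, ∀ u ∈ T, δ / 2 * n ^ (m + 1) ≤ #{T' ∈ G | u ∈ T'} := by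
  obtain ⟨G, hG, hcard, hfull⟩ := exists_full_subfamily G₀ (univ : Finset (Fin n))
    (fun T u => u ∈ T) (δ / 2 * n ^ (m + 1)) (by positivity)
  refine ⟨G, hG, ?_, fun T hT u hu => hfull T hT u (mem_univ _) hu⟩
  rw [← card_pos]
  have hn' : (0 : ℝ) < n := by exact_mod_cast hn
  rw [card_univ, Fintype.card_fin] at hcard
  have h1 : 0 < δ / 2 * (n : ℝ) ^ (m + 2) := by positivity
  have h2 : δ / 2 * (n : ℝ) ^ (m + 1) * n = δ / 2 * n ^ (m + 2) := by ring
  have : (0 : ℝ) < #G := by linarith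
  exact_mod_cast this

/-- Common neighbours of a family of large minimum degree form strong pairs with its vertices. -/
theorem isStrongPair_of_min_degree {n m w : ℕ} {γ : ℝ} {G H : Finset (Finset (Fin n))}
    (hG : ∀ T ∈ G, #T = m + 2)
    (hdeg : ∀ T ∈ G, ∀ u ∈ T, γ * n ^ (m + 1) ≤ #{T' ∈ G | u ∈ T'}) (hn : w < γ * n)
    {a u : Fin n} (ha : ∀ T ∈ G, insert a T ∈ H) (hu : ∃ T ∈ G, u ∈ T) :
    IsStrongPair H w u a := by
  intro W hW huW haW
  obtain ⟨T₀, hT₀, huT₀⟩ := hu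
  have hn0 : (0 : ℝ) < n := by exact_mod_cast u.pos
  by_cases hcon : ∃ T ∈ G, u ∈ T ∧ Disjoint T W
  · obtain ⟨T, hT, huT, hd⟩ := hcon
    exact ⟨insert a T, ha T hT, mem_insert_of_mem huT, mem_insert_self _ _,
      disjoint_insert_left.2 ⟨haW, hd⟩⟩
  · exfalso
    push Not at hcon
    have h1 := card_le_mul_pow_of_meets (m := m + 2) (F := {T ∈ G | u ∈ T}) {u} W (fun T hT => by
      obtain ⟨hT, huT⟩ := mem_filter.1 hT
      obtain ⟨z, hzT, hzW⟩ := not_disjoint_iff.1 (hcon T hT huT)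
      refine ⟨hG T hT, by simpa using huT, z, hzW, ?_, hzT⟩
      rintro h
      exact huW (mem_singleton.1 h ▸ hzW))
    simp only [card_singleton, Nat.add_sub_cancel] at h1
    have h1' : (#{T ∈ G | u ∈ T} : ℝ) ≤ #W * n ^ m := by exact_mod_cast h1
    have h2 := hdeg T₀ hT₀ u huT₀
    have h3 : (#W : ℝ) ≤ w := by exact_mod_cast hW
    have h4 : γ * n * (n : ℝ) ^ m ≤ w * n ^ m := by
      calc γ * n * (n : ℝ) ^ m = γ * n ^ (m + 1) := by ring
        _ ≤ #W * n ^ m := h2.trans h1'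
        _ ≤ _ := by gcongr
    exact absurd (le_of_mul_le_mul_right h4 (by positivity)) (not_le.2 hn)

theorem mul_le_card_biUnion_of_min_degree {n m : ℕ} {γ : ℝ} {G : Finset (Finset (Fin n))}
    (hG : ∀ T ∈ G, #T = m + 2) (hne : G.Nonempty)
    (hdeg : ∀ T ∈ G, ∀ u ∈ T, γ * n ^ (m + 1) ≤ #{T' ∈ G | u ∈ T'}) :
    γ * n ≤ #(G.biUnion id) := by
  obtain ⟨T₀, hT₀⟩ := hne
  obtain ⟨u, hu⟩ : T₀.Nonempty := card_pos.1 (by rw [hG _ hT₀]; omega)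
  have hn0 : (0 : ℝ) < n := by exact_mod_cast u.pos
  have h1 := card_le_mul_pow_of_meets (m := m + 2) (F := {T ∈ G | u ∈ T}) {u} (G.biUnion id)
    (fun T hT => by
      obtain ⟨hT, huT⟩ := mem_filter.1 hT
      obtain ⟨b, hbT, hbu⟩ := exists_mem_ne (by rw [hG T hT]; omega : 1 < #T) u
      exact ⟨hG T hT, by simpa using huT, b, mem_biUnion.2 ⟨T, hT, hbT⟩, by simpa using hbu, hbT⟩)
  simp only [card_singleton, Nat.add_sub_cancel] at h1
  have h1' : (#{T ∈ G | u ∈ T} : ℝ) ≤ #(G.biUnion id) * n ^ m := by exact_mod_cast h1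
  have h2 := hdeg T₀ hT₀ u hu
  have h4 : γ * n * (n : ℝ) ^ m ≤ #(G.biUnion id) * n ^ m := by
    calc γ * n * (n : ℝ) ^ m = γ * n ^ (m + 1) := by ring
      _ ≤ _ := h2.trans h1'
  exact le_of_mul_le_mul_right h4 (by positivity)

/-- Two members of `𝒯` inside `X` share one vertex and carry distinct colours outside a set `A` of
`q - 1` colours, all of which form strong pairs with the vertices of `X`. -/
def HasAdjacentColors {n : ℕ} (H : Finset (Finset (Fin n))) (w q : ℕ)
    (𝒯 : Finset (Finset (Fin n))) (L : Finset (Fin n) → Finset (Fin n)) : Prop :=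
  ∃ (A X T₀ T₁ : Finset (Fin n)) (u₀ u₁ u₂ c c' : Fin n), #A + 1 = q ∧ w < #X ∧ Disjoint A X ∧
    (∀ u ∈ X, ∀ a ∈ A, IsStrongPair H w u a) ∧ T₀ ∈ 𝒯 ∧ T₁ ∈ 𝒯 ∧ T₀ ⊆ X ∧ T₁ ⊆ X ∧
    T₀ ∩ T₁ = {u₁} ∧ u₀ ∈ T₀ ∧ u₀ ≠ u₁ ∧ u₂ ∈ T₁ ∧ u₂ ≠ u₁ ∧
    c ∈ L T₀ \ A ∧ c' ∈ L T₁ \ A ∧ c ≠ c' ∧ c ∉ X ∧ c' ∉ X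

/-- If the members of a dense family carry lists of neighbours with a common part `A`, then either
a positive proportion of the lists share a further colour, or only one colour is left and adjacent
members with distinct colours appear. -/
theorem exists_popular_color {n m t q w : ℕ} {δ η : ℝ} (hδ : 0 < δ) (hη : 0 < η) (ht : 1 ≤ t)
    (hq : q ≤ t + 1) (hηδ : 4 * (2 * t + 2 : ℕ) * (t + 1 : ℕ) * η ≤ δ / 2)
    {H G₀ : Finset (Finset (Fin n))} (hH : ∀ e ∈ H, #e = m + 3)
    (hfree : LinearPathFree (m + 3) (2 * t + 2) H)
    (hw : 2 * (m + 3 + 1) * (2 * t + 2 + 1) ≤ w) (hn : 0 < n) (hnw : w < δ / 2 * n)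
    (hG₀ : ∀ T ∈ G₀, #T = m + 2) (hcard : δ * n ^ (m + 2) ≤ #G₀)
    (L : Finset (Fin n) → Finset (Fin n)) (Y : Finset (Fin n))
    (hL : ∀ T ∈ G₀, #(L T) = q ∧ L T ⊆ Y ∧ Disjoint T Y ∧ ∀ a ∈ L T, insert a T ∈ H)
    {A : Finset (Fin n)} (hA : #A < q) (hAL : ∀ T ∈ G₀, A ⊆ L T) :
    (∃ v ∉ A, η ^ 2 / (m + 2) * n ^ (m + 2) ≤ (#{T ∈ G₀ | v ∈ L T} : ℝ)) ∨
      HasAdjacentColors H w q G₀ L := by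
  by_contra! hcon
  obtain ⟨hcon, hadj⟩ := hcon
  have : Nonempty (Fin n) := ⟨⟨0, hn⟩⟩
  obtain ⟨G, hGG, hne, hdeg⟩ := exists_subfamily_min_degree hδ hn G₀ hcard
  have hG : ∀ T ∈ G, #T = m + 2 := fun T hT => hG₀ T (hGG hT)
  have hwr : (2 * (2 * t + 2 : ℕ) * (m + 2) : ℝ) < δ / 2 * n := by
    refine lt_of_le_of_lt ?_ hnw
    exact_mod_cast (by nlinarith : 2 * (2 * t + 2) * (m + 2) ≤ w)
  obtain ⟨T, u, hT, hu, huT, hTT⟩ := exists_path_of_light_lists (r := 2 * t + 2) (s := t + 1) hη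
    (fun T => L T \ A) hG hne
    (fun T hT => (card_le_card sdiff_subset).trans ((hL T (hGG hT)).1.trans_le hq))
    hdeg (fun v => by
      by_cases hv : v ∈ A
      · simp only [mem_sdiff, hv, not_true_eq_false, and_false, filter_false, card_empty,
          Nat.cast_zero]
        positivity
      · refine le_trans ?_ (hcon v hv).le
        exact_mod_cast card_le_card fun T hT => by
          obtain ⟨h1, h2⟩ := mem_filter.1 hT
          exact mem_filter.2 ⟨hGG h1, (mem_sdiff.1 h2).1⟩) hηδ hwr
  have hLc : ∀ T ∈ G, #(L T \ A) = q - #A := fun T hT => by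
    rw [card_sdiff_of_subset (hAL T (hGG hT)), (hL T (hGG hT)).1]
  have huY : ∀ j ≤ 2 * t + 2, u j ∉ Y := by
    intro j hj
    obtain ⟨i, hi, h⟩ : ∃ i < 2 * t + 2, u j ∈ T i := by
      rcases Nat.lt_or_ge j (2 * t + 2) with h | h
      · exact ⟨j, h, (hT j h).2.1⟩
      · obtain rfl : j = 2 * t + 1 + 1 := by omega
        exact ⟨2 * t + 1, by omega, (hT _ (by omega)).2.2⟩
    exact disjoint_left.1 (hL _ (hGG (hT i hi).1)).2.2.1 h
  have hcol : ∀ i < 2 * t + 2, ∀ c ∈ L (T i) \ A, c ∈ Y ∧ insert c (T i) ∈ H := by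
    intro i hi c hc
    obtain ⟨h1, h2⟩ := hL _ (hGG (hT i hi).1)
    have hc := (mem_sdiff.1 hc).1
    exact ⟨h2.1 hc, h2.2.2 c hc⟩
  have hmeet : ∀ i j, i < j → j < 2 * t + 2 → ∀ c ∈ L (T i) \ A, ∀ c' ∈ L (T j) \ A, c ≠ c' →
      insert c (T i) ∩ insert c' (T j) ⊆ {u j} := by
    intro i j hij hj c hc c' hc' hcc v hv
    have hcY := (hcol i (by omega) c hc).1
    have hcY' := (hcol j hj c' hc').1
    have hTi := (hL _ (hGG (hT i (by omega)).1)).2.2.1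
    have hTj := (hL _ (hGG (hT j hj).1)).2.2.1
    obtain ⟨hv1, hv2⟩ := mem_inter.1 hv
    rcases mem_insert.1 hv1 with rfl | hv1 <;> rcases mem_insert.1 hv2 with rfl | hv2
    · exact absurd rfl hcc
    · exact absurd hcY (disjoint_left.1 hTj hv2)
    · exact absurd hcY' (disjoint_left.1 hTi hv1)
    · exact (hTT i j hij hj).1 (mem_inter.2 ⟨hv1, hv2⟩)
  rcases (Nat.succ_le_of_lt hA).lt_or_eq with hA | hA
  · obtain ⟨c, hc, hcc⟩ := exists_seq_of_greedy (2 * t + 2) (fun i c => c ∈ L (T i) \ A)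
      (fun i j c c' => j = i + 1 → c ≠ c') (by
        intro l hl f _ _
        obtain ⟨c, hc, hne⟩ := exists_mem_ne
          (by rw [hLc _ (hT l hl).1]; omega : 1 < #(L (T l) \ A)) (f (l - 1))
        refine ⟨c, hc, fun i hi h => ?_⟩
        obtain rfl : i = l - 1 := by omega
        exact hne.symm)
    have hcd : ∀ i j, i < j → j < 2 * t + 2 → c i ≠ c j := by
      intro i j hij hj h
      rcases Nat.lt_or_ge (i + 1) j with h1 | h1
      · exact disjoint_left.1 ((hTT i j hij hj).2 h1) (hc i (by omega)) (h ▸ hc j hj)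
      · exact hcc i j hij hj (by omega) h
    refine not_linearPathFree_of_joints hH u hu (fun _ => True)
      (fun i => insert (c i) (T i)) (fun i hi _ => ?_) (fun i j hij hj _ _ => ?_)
      (fun i hi h => absurd trivial h) hw hfree
    · obtain ⟨h1, h2⟩ := hcol i hi _ (hc i hi)
      refine ⟨h2, mem_insert_of_mem (hT i hi).2.1, mem_insert_of_mem (hT i hi).2.2,
        fun j hj h => ?_⟩
      rcases mem_insert.1 h with h | h
      · exact absurd (h ▸ h1) (huY j hj)
      · exact huT i hi j hj h
    · exact hmeet i j hij hj _ (hc i (by omega)) _ (hc j hj) (hcd i j hij hj)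
  · have hone : ∀ i < 2 * t + 2, ∃ c, c ∈ L (T i) \ A := fun i hi =>
      card_pos.1 (by rw [hLc _ (hT i hi).1]; omega)
    choose! c hc using hone
    have hX : w < #(G.biUnion id) := by
      exact_mod_cast hnw.trans_le (mul_le_card_biUnion_of_min_degree hG hne hdeg)
    have hXY : Disjoint (G.biUnion id) Y :=
      (disjoint_biUnion_left _ _ _).2 fun T hT => (hL T (hGG hT)).2.2.1
    have hAY : A ⊆ Y := by
      obtain ⟨T, hT⟩ := hne
      exact (hAL T (hGG hT)).trans (hL T (hGG hT)).2.1
    have hs : ∀ u ∈ G.biUnion id, ∀ a ∈ A, IsStrongPair H w u a := fun u hu a ha =>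
      isStrongPair_of_min_degree hG hdeg hnw
        (fun T hT => (hL T (hGG hT)).2.2.2 a (hAL T (hGG hT) ha)) (by simpa using hu)
    obtain ⟨i, hi, hne'⟩ : ∃ i, i + 2 < 2 * t + 2 + 1 ∧ c i ≠ c (i + 1) := by
      by_cases h01 : c 0 = c 1
      · refine ⟨1, by omega, fun h12 => ?_⟩
        exact disjoint_left.1 ((hTT 0 2 (by omega) (by omega)).2 (by omega)) (hc 0 (by omega))
          (h01.trans h12 ▸ hc 2 (by omega))
      · exact ⟨0, by omega, h01⟩
    have hTi := hT i (by omega)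
    have hTi' := hT (i + 1) (by omega)
    refine hadj ⟨A, G.biUnion id, T i, T (i + 1), u i, u (i + 1), u (i + 2), c i, c (i + 1), hA, hX,
      disjoint_of_subset_left hAY hXY.symm, hs, hGG hTi.1, hGG hTi'.1,
      subset_biUnion_of_mem id hTi.1, subset_biUnion_of_mem id hTi'.1, ?_, hTi.2.1,
      hu i (i + 1) (by omega) (by omega), hTi'.2.2, (hu (i + 1) (i + 2) (by omega) (by omega)).symm,
      hc i (by omega), hc (i + 1) (by omega), hne',
      disjoint_right.1 hXY (hcol i (by omega) _ (hc i (by omega))).1,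
      disjoint_right.1 hXY (hcol (i + 1) (by omega) _ (hc (i + 1) (by omega))).1⟩
    refine Subset.antisymm (hTT i (i + 1) (by omega) (by omega)).1 ?_
    rw [singleton_subset_iff, mem_inter]
    exact ⟨hTi.2.2, hTi'.2.1⟩

/-- The vertices extending `T` to an edge of `H`. -/
noncomputable def coneighbors {n : ℕ} (H : Finset (Finset (Fin n))) (T : Finset (Fin n)) :
    Finset (Fin n) :=
  {v | v ∉ T ∧ insert v T ∈ H}

theorem mem_coneighbors {n : ℕ} {H : Finset (Finset (Fin n))} {T : Finset (Fin n)} {v : Fin n} :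
    v ∈ coneighbors H T ↔ v ∉ T ∧ insert v T ∈ H := by
  simp [coneighbors]

theorem eventually_lt_mul_natCast (C : ℝ) {δ : ℝ} (hδ : 0 < δ) :
    ∀ᶠ n : ℕ in Filter.atTop, C < δ * n :=
  (tendsto_natCast_atTop_atTop.const_mul_atTop hδ).eventually_gt_atTop C

theorem HasAdjacentColors.mono {n w q : ℕ} {H 𝒯 𝒯' : Finset (Finset (Fin n))}
    {L : Finset (Fin n) → Finset (Fin n)} (h : HasAdjacentColors H w q 𝒯 L) (hsub : 𝒯 ⊆ 𝒯') :
    HasAdjacentColors H w q 𝒯' L := by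
  obtain ⟨A, X, T₀, T₁, u₀, u₁, u₂, c, c', h1, h2, h3, h4, h5, h6, h7⟩ := h
  exact ⟨A, X, T₀, T₁, u₀, u₁, u₂, c, c', h1, h2, h3, h4, hsub h5, hsub h6, h7⟩

/-- If the members of a dense family carry lists of `q ≤ t + 1` neighbours, then either some list
forms strong pairs with linearly many vertices or adjacent members with distinct colours appear. -/
theorem exists_popular_list (m : ℕ) {t q w : ℕ} (ht : 1 ≤ t) (hq : q ≤ t + 1)
    (hw : 2 * (m + 3 + 1) * (2 * t + 2 + 1) ≤ w) {ε : ℝ} (hε : 0 < ε) :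
    ∃ γ > (0 : ℝ), ∀ᶠ n : ℕ in Filter.atTop, ∀ H : Finset (Finset (Fin n)), (∀ e ∈ H, #e = m + 3) →
      LinearPathFree (m + 3) (2 * t + 2) H → ∀ (𝒯 : Finset (Finset (Fin n)))
      (L : Finset (Fin n) → Finset (Fin n)),
      (∀ T ∈ 𝒯, #T = m + 2 ∧ #(L T) = q ∧ L T ⊆ coneighbors H T) → ε * n ^ (m + 2) ≤ #𝒯 →
      (∃ A X : Finset (Fin n), #A = q ∧ γ * n ≤ #X ∧ Disjoint A X ∧
        (∀ u ∈ X, ∀ a ∈ A, IsStrongPair H w u a) ∧ ∃ T ∈ 𝒯, L T = A) ∨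
      HasAdjacentColors H w q 𝒯 L := by
  set κ : ℝ := 8 * (2 * t + 2 : ℕ) * (t + 1 : ℕ) with hκ
  have hκ0 : 0 < κ := by positivity
  set δ : ℕ → ℝ := fun j =>
    Nat.rec (ε / 2 ^ (q + (m + 2))) (fun _ d => (d / κ) ^ 2 / (m + 2)) j with hδ
  have hδ1 : ∀ j, δ (j + 1) = (δ j / κ) ^ 2 / (m + 2) := fun j => rfl
  have hδ0 : ∀ j, 0 < δ j := by
    intro j
    induction j with
    | zero => exact div_pos hε (by positivity)
    | succ j ih => rw [hδ1]; positivity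
  have hev : ∀ᶠ n : ℕ in Filter.atTop, ∀ j ∈ range (q + 1), (w : ℝ) < δ j / 2 * n :=
    (Filter.eventually_all_finset _).2 fun j _ =>
      eventually_lt_mul_natCast w (half_pos (hδ0 j))
  refine ⟨δ q / 2, half_pos (hδ0 q), ?_⟩
  filter_upwards [hev, Filter.eventually_gt_atTop 0] with n hn hn0 H hH hfree 𝒯 L hL hcard
  by_contra! hcon
  obtain ⟨hpop, hadj⟩ := hcon
  obtain ⟨Y, hY⟩ := exists_separating_set 𝒯 L (q + (m + 2))
    (fun T hT => disjoint_left.2 fun v hv => (mem_coneighbors.1 ((hL T hT).2.2 hv)).1)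
    (fun T hT => by rw [(hL T hT).1, (hL T hT).2.1])
  set 𝒯' := {T ∈ 𝒯 | L T ⊆ Y ∧ Disjoint T Y} with h𝒯'
  have hL' : ∀ T ∈ 𝒯', #(L T) = q ∧ L T ⊆ Y ∧ Disjoint T Y ∧
      ∀ a ∈ L T, insert a T ∈ H := fun T hT => by
    obtain ⟨h1, h2, h3⟩ := mem_filter.1 hT
    exact ⟨(hL T h1).2.1, h2, h3, fun a ha => (mem_coneighbors.1 ((hL T h1).2.2 ha)).2⟩
  have hTc' : ∀ T ∈ 𝒯', #T = m + 2 := fun T hT => (hL T (mem_filter.1 hT).1).1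
  have key : ∀ j ≤ q, ∃ (A : Finset (Fin n)) (G : Finset (Finset (Fin n))), #A = j ∧ G ⊆ 𝒯' ∧
      (∀ T ∈ G, A ⊆ L T) ∧ δ j * n ^ (m + 2) ≤ #G := by
    intro j
    induction j with
    | zero =>
      refine fun _ => ⟨∅, 𝒯', rfl, Subset.rfl, by simp, ?_⟩
      have h1 : (#𝒯 : ℝ) ≤ 2 ^ (q + (m + 2)) * #𝒯' := by exact_mod_cast hY
      have h2 : δ 0 * n ^ (m + 2) = ε * n ^ (m + 2) / 2 ^ (q + (m + 2)) := by
        change ε / 2 ^ (q + (m + 2)) * (n : ℝ) ^ (m + 2) = _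
        ring
      rw [h2, div_le_iff₀ (by positivity)]
      linarith
    | succ j ih =>
      intro hj
      obtain ⟨A, G, hA, hG, hAL, hGc⟩ := ih (by omega)
      rcases exists_popular_color (hδ0 j) (div_pos (hδ0 j) hκ0) ht hq
        (by rw [hκ]; apply le_of_eq; field_simp; ring) hH hfree hw hn0
        (hn j (mem_range.2 (by omega))) (fun T hT => hTc' T (hG hT)) hGc L Y
        (fun T hT => hL' T (hG hT)) (by omega) hAL with ⟨v, hvA, hv⟩ | h
      · refine ⟨insert v A, {T ∈ G | v ∈ L T}, by rw [card_insert_of_notMem hvA, hA],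
          (filter_subset _ _).trans hG, fun T hT => ?_, hδ1 j ▸ hv⟩
        obtain ⟨h1, h2⟩ := mem_filter.1 hT
        exact insert_subset h2 (hAL T h1)
      · exact absurd (h.mono (hG.trans (filter_subset _ _))) hadj
  obtain ⟨A, G₀, hA, hG₀, hAL, hGc⟩ := key q le_rfl
  obtain ⟨G, hGG, hne, hdeg⟩ := exists_subfamily_min_degree (hδ0 q) hn0 G₀ hGc
  have hG : ∀ T ∈ G, #T = m + 2 := fun T hT => hTc' T (hG₀ (hGG hT))
  have hGL := fun T hT => hL' T (hG₀ (hGG hT))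
  obtain ⟨T, hT⟩ := hne
  have hLA : L T = A :=
    (eq_of_subset_of_card_le (hAL T (hGG hT)) (by rw [(hGL T hT).1, hA])).symm
  refine hpop A (G.biUnion id) hA (mul_le_card_biUnion_of_min_degree hG ⟨T, hT⟩ hdeg) ?_ ?_ T
    (mem_filter.1 (hG₀ (hGG hT))).1 hLA
  · refine (disjoint_biUnion_right _ _ _).2 fun T' hT' => ?_
    exact disjoint_of_subset_left (hLA ▸ (hGL T hT).2.1) (hGL T' hT').2.2.1.symm
  · exact fun u hu a ha => isStrongPair_of_min_degree hG hdeg (hn q (mem_range.2 (by omega)))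
      (fun T' hT' => (hGL T' hT').2.2.2 a (hAL T' (hGG hT') ha)) (by simpa using hu)

/-- In a linear-path-free hypergraph few sets of size `k - 1` have codegree above `t`. -/
theorem eventually_card_coneighbors_le (m : ℕ) {t : ℕ} (ht : 1 ≤ t) {ε : ℝ} (hε : 0 < ε) :
    ∀ᶠ n : ℕ in Filter.atTop, ∀ H : Finset (Finset (Fin n)), (∀ e ∈ H, #e = m + 3) →
      LinearPathFree (m + 3) (2 * t + 2) H →
      (#{T ∈ powersetCard (m + 2) univ | t + 1 ≤ #(coneighbors H T)} : ℝ) ≤ ε * n ^ (m + 2) := by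
  set w := 2 * (m + 3 + 1) * (2 * t + 2 + 1) with hw
  obtain ⟨γ, hγ, hev⟩ := exists_popular_list m ht le_rfl hw.ge hε
  filter_upwards [hev, eventually_lt_mul_natCast w hγ] with n hn hnw H hH hfree
  by_contra! hcard
  set 𝒯 : Finset (Finset (Fin n)) :=
    {T ∈ powersetCard (m + 2) univ | t + 1 ≤ #(coneighbors H T)} with h𝒯
  have hL : ∀ T ∈ 𝒯, ∃ L ⊆ coneighbors H T, #L = t + 1 := fun T hT =>
    exists_subset_card_eq (mem_filter.1 hT).2
  choose! L hLs hLc using hL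
  rcases hn H hH hfree 𝒯 L (fun T hT => ⟨(mem_powersetCard.1 (mem_filter.1 hT).1).2, hLc T hT,
    hLs T hT⟩) hcard.le with ⟨A, X, hA, hX, hAX, hs, -⟩ | h
  · replace hX : w < #X := by exact_mod_cast hnw.trans_le hX
    obtain ⟨v, -⟩ : X.Nonempty := card_pos.1 (by omega)
    have : Nonempty (Fin n) := ⟨v⟩
    obtain ⟨a, haA, ha⟩ := A.exists_injective_seq
    rw [hA] at haA ha
    obtain ⟨y, hyX, hy⟩ := exists_injective_seq (t + 2) (· ∈ X) (fun W hW => by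
      obtain ⟨v, hv, hvW⟩ := exists_mem_notMem_of_card_lt_card (s := W) (t := X) (by nlinarith)
      exact ⟨v, hvW, hv⟩)
    have hs' : ∀ i < t + 1, ∀ j < t + 2, IsStrongPair H w (y j) (a i) := fun i hi j hj =>
      hs _ (hyX j hj) _ (haA i hi)
    refine not_linearPathFree_of_alternating hH hw.ge a y (fun i j hij hj => ha i j hij (by omega))
      (fun i j hij hj => hy i j hij (by omega)) (fun i hi j hj h => ?_)
      (fun i hi => ⟨hs' i (by omega) i (by omega), (hs' i (by omega) (i + 1) (by omega)).symm⟩)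
      hfree
    exact disjoint_left.1 hAX (haA i (by omega)) (h ▸ hyX j (by omega))
  · obtain ⟨A, X, T₀, T₁, u₀, u₁, u₂, c, c', hA, hX, hAX, hs, hT₀, hT₁, hTX₀, hTX₁, hTT, hu₀, hu₀₁,
      hu₂, hu₂₁, hc, hc', hcc, hcX, hcX'⟩ := h
    obtain ⟨hc, hcA⟩ := mem_sdiff.1 hc
    obtain ⟨hc', hcA'⟩ := mem_sdiff.1 hc'
    have hu₁ := mem_inter.1 (hTT ▸ mem_singleton_self u₁)
    refine not_linearPathFree_of_two_edges hH hw.ge (by omega : #A = t) hAX hs hX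
      (mem_coneighbors.1 (hLs _ hT₀ hc)).2 (mem_coneighbors.1 (hLs _ hT₁ hc')).2
      (disjoint_insert_right.2 ⟨hcA, disjoint_of_subset_right hTX₀ hAX⟩)
      (disjoint_insert_right.2 ⟨hcA', disjoint_of_subset_right hTX₁ hAX⟩) (v₁ := u₁) ?_
      (mem_insert_of_mem hu₀) hu₀₁ (mem_insert_of_mem hu₂) hu₂₁ (hTX₁ hu₂) hfree
    rw [insert_inter_of_notMem, inter_insert_of_notMem, hTT]
    · exact fun h => hcX' (hTX₀ h)
    · rw [mem_insert, not_or]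
      exact ⟨hcc, fun h => hcX (hTX₁ h)⟩

/-- The sets of size `m` with more than `t` coneighbors. -/
noncomputable def thickSets {n : ℕ} (H : Finset (Finset (Fin n))) (m t : ℕ) :
    Finset (Finset (Fin n)) :=
  {T ∈ powersetCard m univ | t + 1 ≤ #(coneighbors H T)}

/-- Every `(k - 1)`-set can be assigned at most `t` neighbours, strongly paired with its vertices,
so that in total few of the edges are lost. -/
theorem exists_strong_lists {n m t w : ℕ} {H : Finset (Finset (Fin n))} (hH : ∀ e ∈ H, #e = m + 3)
    (hfree : LinearPathFree (m + 3) (2 * t + 2) H)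
    (hw : 2 * (m + 3 + 1) * (2 * t + 2 + 1) = w) :
    ∃ L : Finset (Fin n) → Finset (Fin n),
      (∀ T, #T = m + 2 → L T ⊆ coneighbors H T ∧ #(L T) ≤ t ∧
        ∀ v ∈ L T, ∀ u ∈ T, IsStrongPair H w u v) ∧
      (2 * #H : ℝ) ≤ t * n.choose (m + 2) + ∑ T ∈ powersetCard (m + 2) univ, (#(L T) : ℝ) +
        (w + 1) * (m + 4) * #(thickSets H (m + 2) t) := by
  set 𝒦 := thickSets H (m + 2) t with h𝒦
  set θ : Finset (Fin n) → Finset (Fin n) := fun e => {z ∈ e | e.erase z ∉ 𝒦} with hθ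
  set Φ : Finset (Fin n) → Finset (Fin n) :=
    fun e => {z ∈ θ e | ∀ z' ∈ e, z' ≠ z → e.erase z' ∈ 𝒦} with hΦ
  set H₂ : Finset (Finset (Fin n)) := {e ∈ H | ∀ z ∈ e, e.erase z ∈ 𝒦} with hH₂
  set 𝓟 : Finset (Σ _ : Finset (Fin n), Fin n) := H.sigma θ with h𝓟
  set 𝓕 : Finset (Σ _ : Finset (Fin n), Fin n) := H.sigma Φ with h𝓕
  have herase : ∀ e ∈ H, ∀ z ∈ e, #(e.erase z) = m + 2 := fun e he z hz => by
    rw [card_erase_of_mem hz, hH e he]; omega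
  have hthin : ∀ T, #T = m + 2 → T ∉ 𝒦 → #(coneighbors H T) ≤ t := fun T hT h => by
    by_contra hlt
    exact h (mem_filter.2 ⟨mem_powersetCard.2 ⟨subset_univ _, hT⟩, by omega⟩)
  have hsum : 2 * #H ≤ 2 * #H₂ + #𝓟 + #𝓕 := by
    have h1 : ∀ e ∈ H, 2 ≤ 2 * (if ∀ z ∈ e, e.erase z ∈ 𝒦 then 1 else 0) + #(θ e) + #(Φ e) := by
      intro e he
      rcases Nat.lt_or_ge 1 #(θ e) with h | h
      · omega
      · split_ifs with h2
        · omega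
        · push Not at h2
          obtain ⟨z, hz, hz𝒦⟩ := h2
          have hzθ : z ∈ θ e := mem_filter.2 ⟨hz, hz𝒦⟩
          have hzΦ : z ∈ Φ e := mem_filter.2 ⟨hzθ, fun z' hz' hne => by
            by_contra h3
            exact hne (card_le_one.1 h z' (mem_filter.2 ⟨hz', h3⟩) z hzθ)⟩
          have h4 := card_pos.2 ⟨z, hzθ⟩
          have h5 := card_pos.2 ⟨z, hzΦ⟩
          omega
    have h2 := sum_le_sum h1
    rw [sum_const, smul_eq_mul, sum_add_distrib, sum_add_distrib, ← mul_sum, sum_boole,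
      ← card_sigma, ← card_sigma] at h2
    simp only [Nat.cast_id] at h2
    linarith
  have hH₂c : (#H₂ : ℝ) ≤ (w + 1) * #𝒦 := by
    have := hfree.card_le_mul_shadow (by omega) hH (filter_subset _ H) 𝒦
      (fun e he => by simpa [hH₂] using (mem_filter.1 he).2)
    rwa [hw] at this
  have h𝓟c : #𝓟 ≤ t * n.choose (m + 2) := by
    have h1 := card_le_mul_card_image_of_maps_to (s := 𝓟) (f := fun p => p.1.erase p.2)
      (t := powersetCard (m + 2) (univ : Finset (Fin n))) (fun p hp => by
        obtain ⟨h1, h2⟩ := mem_sigma.1 hp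
        exact mem_powersetCard.2 ⟨subset_univ _, herase _ h1 _ (mem_filter.1 h2).1⟩) t
      (fun T hT => by
        rcases ({p ∈ 𝓟 | p.1.erase p.2 = T}).eq_empty_or_nonempty with h | ⟨p, hp⟩
        · simp [h]
        obtain ⟨hp₁, rfl⟩ := mem_filter.1 hp
        have hp𝒦 : p.1.erase p.2 ∉ 𝒦 := by
          simpa [hθ] using (mem_filter.1 (mem_sigma.1 hp₁).2).2
        refine le_trans (card_le_card_of_injOn (fun p => p.2) (fun q hq => ?_) ?_) (hthin _
          (mem_powersetCard.1 hT).2 hp𝒦)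
        · obtain ⟨hq, hqT⟩ := mem_filter.1 hq
          obtain ⟨h1, h2⟩ := mem_sigma.1 hq
          rw [← hqT]
          exact mem_coneighbors.2 ⟨notMem_erase _ _, by
            rwa [insert_erase (mem_filter.1 h2).1]⟩
        · intro q hq q' hq' (heq : q.2 = q'.2)
          obtain ⟨hq, hqT⟩ := mem_filter.1 hq
          obtain ⟨hq', hqT'⟩ := mem_filter.1 hq'
          have e1 := insert_erase (mem_filter.1 (mem_sigma.1 hq).2).1
          have e2 := insert_erase (mem_filter.1 (mem_sigma.1 hq').2).1
          rw [hqT] at e1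
          rw [hqT', ← heq, e1] at e2
          exact Sigma.ext e2 (heq_of_eq heq))
    simpa using h1
  obtain ⟨𝓕', h𝓕', hcard, hfull⟩ := exists_full_subfamily 𝓕 (𝒦.sigma id)
    (fun p b => p.2 = b.2 ∧ b.1 ⊆ p.1) ((w : ℝ) + 1) (by positivity)
  have hBc : #(𝒦.sigma id) = (m + 2) * #𝒦 := by
    rw [card_sigma, mul_comm, ← smul_eq_mul, ← sum_const]
    exact sum_congr rfl fun T hT => (mem_powersetCard.1 (mem_filter.1 hT).1).2
  have h𝓕m : ∀ e z, (⟨e, z⟩ : Σ _ : Finset (Fin n), Fin n) ∈ 𝓕' → e ∈ H ∧ z ∈ e ∧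
      e.erase z ∉ 𝒦 ∧ ∀ z' ∈ e, z' ≠ z → e.erase z' ∈ 𝒦 := fun e z h => by
    obtain ⟨h1, h2⟩ := mem_sigma.1 (h𝓕' h)
    obtain ⟨h2, h3⟩ := mem_filter.1 h2
    obtain ⟨h2, h4⟩ := mem_filter.1 h2
    exact ⟨h1, h2, h4, h3⟩
  refine ⟨fun T => {v | v ∉ T ∧ (⟨insert v T, v⟩ : Σ _ : Finset (Fin n), Fin n) ∈ 𝓕'},
    fun T hT => ⟨fun v hv => ?_, ?_, fun v hv u hu => ?_⟩, ?_⟩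
  · obtain ⟨h1, h2⟩ := (mem_filter.1 hv).2
    exact mem_coneighbors.2 ⟨h1, (h𝓕m _ _ h2).1⟩
  · rcases eq_empty_or_nonempty
      ({v | v ∉ T ∧ (⟨insert v T, v⟩ : Σ _ : Finset (Fin n), Fin n) ∈ 𝓕'} : Finset (Fin n))
      with h | ⟨v, hv⟩
    · simp [h]
    · obtain ⟨h1, h2⟩ := (mem_filter.1 hv).2
      have h3 := (h𝓕m _ _ h2).2.2.1
      rw [erase_insert h1] at h3
      refine le_trans (card_le_card fun v' hv' => ?_) (hthin T hT h3)
      obtain ⟨h1, h2⟩ := (mem_filter.1 hv').2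
      exact mem_coneighbors.2 ⟨h1, (h𝓕m _ _ h2).1⟩
  · obtain ⟨hvT, hv⟩ := (mem_filter.1 hv).2
    intro W hW huW hvW
    obtain ⟨e, he, hKe, hd⟩ := exists_disjoint_of_exchange
      {e ∈ H | (⟨e, v⟩ : Σ _ : Finset (Fin n), Fin n) ∈ 𝓕'}
      (fun e he => hH e (mem_filter.1 he).1) {v, u} W (by simp [hvW, huW]) (by
        intro e he hKe z hz hzK
        simp only [mem_insert, mem_singleton, not_or] at hzK
        obtain ⟨-, he⟩ := mem_filter.1 he
        obtain ⟨heH, hve, -, h3⟩ := h𝓕m _ _ he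
        have h4 := hfull _ he ⟨e.erase z, v⟩ (mem_sigma.2 ⟨h3 z hz hzK.1,
          mem_erase.2 ⟨Ne.symm hzK.1, hve⟩⟩) ⟨rfl, erase_subset _ _⟩
        have h5 : #{p ∈ 𝓕' | p.2 = v ∧ e.erase z ⊆ p.1} ≤
            #{e' ∈ {e ∈ H | (⟨e, v⟩ : Σ _ : Finset (Fin n), Fin n) ∈ 𝓕'} | e.erase z ⊆ e'} := by
          refine card_le_card_of_injOn (fun p => p.1) ?_ ?_
          · rintro ⟨e', v'⟩ hp
            obtain ⟨hp₁, (rfl : v' = v), h6⟩ := mem_filter.1 hp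
            exact mem_filter.2 ⟨mem_filter.2 ⟨(h𝓕m _ _ hp₁).1, hp₁⟩, h6⟩
          · rintro ⟨e', v'⟩ hp ⟨e'', v''⟩ hp' (h : e' = e'')
            obtain ⟨-, (h6 : v' = v), -⟩ := mem_filter.1 hp
            obtain ⟨-, (h7 : v'' = v), -⟩ := mem_filter.1 hp'
            subst h h6 h7
            rfl
        have h6 : w + 1 ≤ #{p ∈ 𝓕' | p.2 = v ∧ e.erase z ⊆ p.1} := by exact_mod_cast h4
        omega) (mem_filter.2 ⟨(h𝓕m _ _ hv).1, hv⟩)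
      (by simp [insert_subset_iff, hu])
    exact ⟨e, (mem_filter.1 he).1, hKe (by simp), hKe (by simp), hd⟩
  · have h1 : #𝓕' ≤ ∑ T ∈ powersetCard (m + 2) univ,
        #{v | v ∉ T ∧ (⟨insert v T, v⟩ : Σ _ : Finset (Fin n), Fin n) ∈ 𝓕'} := by
      rw [card_eq_sum_card_fiberwise (f := fun p => p.1.erase p.2)
        (t := powersetCard (m + 2) (univ : Finset (Fin n)))]
      · refine sum_le_sum fun T hT => card_le_card_of_injOn (fun p => p.2) ?_ ?_
        · rintro ⟨e, z⟩ hp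
          obtain ⟨hp₁, rfl⟩ := mem_filter.1 hp
          have h2 := (h𝓕m _ _ hp₁).2.1
          refine mem_filter.2 ⟨mem_univ _, notMem_erase _ _, ?_⟩
          simpa only [insert_erase h2] using hp₁
        · rintro ⟨e, z⟩ hp ⟨e', z'⟩ hp' (rfl : z = z')
          obtain ⟨hp, (h2 : e.erase z = T)⟩ := mem_filter.1 hp
          obtain ⟨hp', (h3 : e'.erase z = T)⟩ := mem_filter.1 hp'
          have h4 := insert_erase (h𝓕m _ _ hp).2.1
          rw [h2, ← h3, insert_erase (h𝓕m _ _ hp').2.1] at h4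
          rw [h4]
      · rintro ⟨e, z⟩ hp
        have h2 := h𝓕m _ _ hp
        exact mem_coe.2 (mem_powersetCard.2 ⟨subset_univ _, herase _ h2.1 _ h2.2.1⟩)
    have h1' : (#𝓕' : ℝ) ≤ ∑ T ∈ powersetCard (m + 2) univ,
        (#{v | v ∉ T ∧ (⟨insert v T, v⟩ : Σ _ : Finset (Fin n), Fin n) ∈ 𝓕'} : ℝ) := by
      exact_mod_cast h1
    have hsum' : (2 * #H : ℝ) ≤ 2 * #H₂ + #𝓟 + #𝓕 := by exact_mod_cast hsum
    have h𝓟c' : (#𝓟 : ℝ) ≤ t * n.choose (m + 2) := by exact_mod_cast h𝓟c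
    rw [hBc] at hcard
    push_cast at hcard
    nlinarith

/-- A strongly paired short path `u₀ c u₁ c' u₂` whose end lies in `X` extends to a long one. -/
theorem not_linearPathFree_of_short_path {n k t w : ℕ} {H : Finset (Finset (Fin n))}
    (hH : ∀ e ∈ H, #e = k) (hw : 2 * (k + 1) * (2 * t + 2 + 1) ≤ w)
    {A X : Finset (Fin n)} {u₀ u₁ u₂ c c' : Fin n} (hA : #A + 1 = t) (hX : t + 2 ≤ #X)
    (hAX : Disjoint A X) (hs : ∀ u ∈ X, ∀ a ∈ A, IsStrongPair H w u a) (hu₂ : u₂ ∈ X)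
    (h₀₁ : u₀ ≠ u₁) (h₀₂ : u₀ ≠ u₂) (h₁₂ : u₁ ≠ u₂) (hcc : c ≠ c')
    (hc : c ∉ A ∪ X) (hc' : c' ∉ A ∪ X) (hu₀ : u₀ ∉ insert c (insert c' A))
    (hu₁ : u₁ ∉ insert c (insert c' A)) (hs₀ : IsStrongPair H w u₀ c)
    (hs₁ : IsStrongPair H w u₁ c) (hs₂ : IsStrongPair H w u₁ c') (hs₃ : IsStrongPair H w u₂ c') :
    ¬LinearPathFree k (2 * t + 2) H := by
  simp only [mem_insert, not_or, mem_union] at hc hc' hu₀ hu₁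
  have hYc : t - 1 ≤ #(X \ {u₀, u₁, u₂}) := by
    have h1 := le_card_sdiff {u₀, u₁, u₂} X
    have h2 : #({u₀, u₁, u₂} : Finset (Fin n)) ≤ 3 := card_le_three
    omega
  have : Nonempty (Fin n) := ⟨u₀⟩
  obtain ⟨f, hfA, hf⟩ := A.exists_injective_seq
  obtain ⟨g, hgX, hg⟩ := (X \ {u₀, u₁, u₂}).exists_injective_seq
  have hgm : ∀ i, i + 1 < t → g i ∈ X ∧ g i ≠ u₀ ∧ g i ≠ u₁ ∧ g i ≠ u₂ := fun i hi => by
    simpa using hgX i (by omega)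
  have hfm : ∀ i, i + 1 < t → f i ∈ A := fun i hi => hfA i (by omega)
  have hne : ∀ x ∈ A, ∀ y ∈ X, x ≠ y := fun x hx y hy h => disjoint_left.1 hAX hx (h ▸ hy)
  set a : ℕ → Fin n := fun i => match i with
    | 0 => c
    | 1 => c'
    | i + 2 => f i with ha
  set y : ℕ → Fin n := fun i => match i with
    | 0 => u₀
    | 1 => u₁
    | 2 => u₂
    | i + 3 => g i with hy
  refine not_linearPathFree_of_alternating hH hw a y ?_ ?_ ?_ ?_
  · rintro (_ | _ | i) (_ | _ | j) hij hj
    all_goals first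
      | omega
      | simp only [ha, zero_add]
    · exact fun h => hc.1 (h ▸ hfm j (by omega))
    · exact fun h => hc'.1 (h ▸ hfm j (by omega))
    · exact hf i j (by omega) (by omega)
  · rintro (_ | _ | _ | i) (_ | _ | _ | j) hij hj
    all_goals first
      | omega
      | simp only [hy, zero_add]
    · exact (hgm j (by omega)).2.1.symm
    · exact (hgm j (by omega)).2.2.1.symm
    · exact (hgm j (by omega)).2.2.2.symm
    · exact hg i j (by omega) (by omega)
  · rintro (_ | _ | i) hi (_ | _ | _ | j) hj <;> simp only [ha, hy, zero_add]
    · exact Ne.symm hu₀.1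
    · exact Ne.symm hu₁.1
    · exact fun h => hc.2 (h ▸ hu₂)
    · exact fun h => hc.2 (h ▸ (hgm j (by omega)).1)
    · exact Ne.symm hu₀.2.1
    · exact Ne.symm hu₁.2.1
    · exact fun h => hc'.2 (h ▸ hu₂)
    · exact fun h => hc'.2 (h ▸ (hgm j (by omega)).1)
    · exact fun h => hu₀.2.2 (h ▸ hfm i (by omega))
    · exact fun h => hu₁.2.2 (h ▸ hfm i (by omega))
    · exact hne _ (hfm i (by omega)) _ hu₂
    · exact hne _ (hfm i (by omega)) _ (hgm j (by omega)).1
  · rintro (_ | _ | _ | i) hi <;> simp only [ha, hy, zero_add]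
    · exact ⟨hs₀, hs₁.symm⟩
    · exact ⟨hs₂, hs₃.symm⟩
    · exact ⟨hs _ hu₂ _ (hfm 0 (by omega)), (hs _ (hgm 0 (by omega)).1 _ (hfm 0 (by omega))).symm⟩
    · exact ⟨hs _ (hgm i (by omega)).1 _ (hfm (i + 1) (by omega)),
        (hs _ (hgm (i + 1) (by omega)).1 _ (hfm (i + 1) (by omega))).symm⟩

/-- A positive proportion of sets with `t`-element lists of strong neighbours forces one of the
lists to be strongly paired with linearly many vertices. -/
theorem exists_popular_full_list (m : ℕ) {t w : ℕ} {ε : ℝ} (ht : 1 ≤ t)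
    (hw : 2 * (m + 3 + 1) * (2 * t + 2 + 1) ≤ w) (hε : 0 < ε) :
    ∃ γ > (0 : ℝ), ∀ᶠ n : ℕ in Filter.atTop, ∀ H : Finset (Finset (Fin n)),
      (∀ e ∈ H, #e = m + 3) → LinearPathFree (m + 3) (2 * t + 2) H →
      ∀ (𝒯 : Finset (Finset (Fin n))) (L : Finset (Fin n) → Finset (Fin n)),
        (∀ T ∈ 𝒯, #T = m + 2 ∧ #(L T) = t ∧ L T ⊆ coneighbors H T ∧
          ∀ v ∈ L T, ∀ u ∈ T, IsStrongPair H w u v) →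
        ε * n ^ (m + 2) ≤ #𝒯 →
        ∃ A X : Finset (Fin n), #A = t ∧ γ * n ≤ #X ∧ Disjoint A X ∧
          (∀ u ∈ X, ∀ a ∈ A, IsStrongPair H w u a) ∧ ∃ T ∈ 𝒯, L T = A := by
  obtain ⟨γ, hγ, hev⟩ := exists_popular_list m ht (le_refl t |>.trans (Nat.le_succ t)) hw hε
  refine ⟨γ, hγ, hev.mono fun n hn H hH hfree 𝒯 L hL h𝒯 => ?_⟩
  rcases hn H hH hfree 𝒯 L (fun T hT => ⟨(hL T hT).1, (hL T hT).2.1, (hL T hT).2.2.1⟩) h𝒯 with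
    h | ⟨A, X, T₀, T₁, u₀, u₁, u₂, c, c', hA, hX, hAX, hs, hT₀, hT₁, hT₀X, hT₁X, hTT, hu₀, h₀₁,
      hu₂, h₂₁, hc, hc', hcc, hcX, hcX'⟩
  · exact h
  · obtain ⟨hcL, hcA⟩ := mem_sdiff.1 hc
    obtain ⟨hcL', hcA'⟩ := mem_sdiff.1 hc'
    have hu₁ : u₁ ∈ T₀ ∩ T₁ := by simp [hTT]
    have h₀₂ : u₀ ≠ u₂ := by
      rintro rfl
      exact h₀₁ (mem_singleton.1 (hTT ▸ mem_inter.2 ⟨hu₀, hu₂⟩))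
    have hXn : ∀ x ∈ X, x ∉ insert c (insert c' A) := by
      intro x hx
      simp only [mem_insert, not_or]
      exact ⟨fun h => hcX (h ▸ hx), fun h => hcX' (h ▸ hx), disjoint_right.1 hAX hx⟩
    rw [mem_inter] at hu₁
    refine absurd hfree (not_linearPathFree_of_short_path hH hw hA (by nlinarith) hAX hs
      (hT₁X hu₂) h₀₁ h₀₂ h₂₁.symm hcc (by simp [hcA, hcX]) (by simp [hcA', hcX'])
      (hXn _ (hT₀X hu₀)) (hXn _ (hT₀X hu₁.1)) ((hL _ hT₀).2.2.2 _ hcL _ hu₀)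
      ((hL _ hT₀).2.2.2 _ hcL _ hu₁.1) ((hL _ hT₁).2.2.2 _ hcL' _ hu₁.2)
      ((hL _ hT₁).2.2.2 _ hcL' _ hu₂))

/-- A set meeting `X`, all of whose vertices are strongly paired with `A`, must have `A` equal to
the set `S` that is strongly paired with `X`. -/
theorem LinearPathFree.eq_of_strong_list {n k t w : ℕ} {H : Finset (Finset (Fin n))}
    (hfree : LinearPathFree k (2 * t + 2) H) (hH : ∀ e ∈ H, #e = k) (ht : 1 ≤ t)
    (hw : 2 * (k + 1) * (2 * t + 2 + 1) ≤ w) {S X A T : Finset (Fin n)} {u : Fin n}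
    (hS : #S = t) (hA : #A = t) (hX : w < #X) (hSX : Disjoint S X)
    (hs : ∀ u ∈ X, ∀ s ∈ S, IsStrongPair H w u s) (hT : 2 ≤ #T) (hAT : Disjoint A T)
    (hST : Disjoint S T) (hsT : ∀ v ∈ A, ∀ u ∈ T, IsStrongPair H w u v) (huT : u ∈ T)
    (huX : u ∈ X) : A = S := by
  by_contra hne
  obtain ⟨v, hvA, hvS⟩ : ∃ v ∈ A, v ∉ S := by
    by_contra! h
    exact hne (eq_of_subset_of_card_le h (by omega))
  obtain ⟨y, hyT, hyu⟩ := exists_mem_ne (by omega : 1 < #T) u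
  obtain ⟨s, hsS⟩ := card_pos.1 (by omega : 0 < #S)
  have hw' : t + 6 ≤ w := by nlinarith
  obtain ⟨x, hx⟩ : (X \ {u, y, v}).Nonempty := by
    rw [← card_pos]
    have h1 := le_card_sdiff {u, y, v} X
    have h2 : #({u, y, v} : Finset (Fin n)) ≤ 3 := card_le_three
    omega
  simp only [mem_sdiff, mem_insert, mem_singleton, not_or] at hx
  have hSX' := disjoint_left.1 hSX
  have hST' := disjoint_left.1 hST
  refine not_linearPathFree_of_short_path (A := S.erase s) (X := X.erase v) (u₀ := y) (u₁ := u)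
    (u₂ := x) (c := v) (c' := s) hH hw ?_ ?_ ?_ ?_ ?_ hyu ?_ ?_ ?_ ?_ ?_ ?_ ?_
    (hsT v hvA y hyT) (hsT v hvA u huT) (hs u huX s hsS) (hs x hx.1 s hsS) hfree
  · rw [card_erase_of_mem hsS]; omega
  · have := pred_card_le_card_erase (s := X) (a := v)
    omega
  · exact hSX.mono (erase_subset _ _) (erase_subset _ _)
  · exact fun u hu a ha => hs u (mem_of_mem_erase hu) a (mem_of_mem_erase ha)
  · exact mem_erase.2 ⟨hx.2.2.2, hx.1⟩
  · exact fun h => hx.2.2.1 h.symm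
  · exact fun h => hx.2.1 h.symm
  · exact fun h => hvS (h ▸ hsS)
  · simp [hvS]
  · simpa using fun _ => hSX' hsS
  · simp only [mem_insert, not_or, mem_erase, not_and]
    exact ⟨fun h => disjoint_left.1 hAT hvA (h ▸ hyT), fun h => hST' hsS (h ▸ hyT),
      fun _ h => hST' h hyT⟩
  · simp only [mem_insert, not_or, mem_erase, not_and]
    exact ⟨fun h => disjoint_left.1 hAT hvA (h ▸ huT), fun h => hST' hsS (h ▸ huT),
      fun _ h => hST' h huT⟩

/-- Counting the sets that avoid `Z` and contain a pair from `X × Y`. -/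
theorem card_mul_choose_le_of_pairs {n m : ℕ} (X Y Z : Finset (Fin n))
    (𝒩 : Finset (Finset (Fin n))) (h𝒩 : ∀ T ∈ 𝒩, #T = m + 2)
    (h : ∀ T : Finset (Fin n), #T = m + 2 → Disjoint T Z → ∀ u ∈ X, ∀ v ∈ Y, u ≠ v → u ∈ T →
      v ∈ T → T ∈ 𝒩) :
    #(X \ Z) * (#(Y \ Z) - 1) * (n - 2 - #Z).choose m ≤ (m + 2) ^ 2 * #𝒩 := by
  set P : Finset (Σ _ : Fin n, Fin n) := (X \ Z).sigma fun u => (Y \ Z).erase u with hP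
  have hPc : #(X \ Z) * (#(Y \ Z) - 1) ≤ #P := by
    rw [hP, card_sigma, ← smul_eq_mul, ← sum_const]
    exact sum_le_sum fun u _ => pred_card_le_card_erase
  have hdc : #P * (n - 2 - #Z).choose m ≤ #𝒩 * (m + 2) ^ 2 := by
    refine card_mul_le_card_mul (fun p T => p.1 ∈ T ∧ p.2 ∈ T) (fun p hp => ?_) fun T hT => ?_
    · obtain ⟨hu, hv⟩ := mem_sigma.1 hp
      obtain ⟨hvu, hv⟩ := mem_erase.1 hv
      obtain ⟨huX, huZ⟩ := mem_sdiff.1 hu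
      obtain ⟨hvY, hvZ⟩ := mem_sdiff.1 hv
      have h1 := card_filter_superset_disjoint (m + 2) {p.1, p.2} Z (by simp [huZ, hvZ])
        (by rw [card_pair hvu.symm]; omega)
      rw [card_pair hvu.symm, Nat.add_sub_cancel] at h1
      rw [← h1]
      refine card_le_card fun T hT => ?_
      obtain ⟨hT, hpT, hTZ⟩ := mem_filter.1 hT
      simp only [insert_subset_iff, singleton_subset_iff] at hpT
      exact (mem_bipartiteAbove _).2 ⟨h T (mem_powersetCard.1 hT).2 hTZ _ huX _ hvY hvu.symm
        hpT.1 hpT.2, hpT⟩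
    · refine (card_le_card_of_injOn (t := T ×ˢ T) (fun p => (p.1, p.2)) (fun p hp => ?_) ?_).trans
        (by rw [card_product, h𝒩 T hT, sq])
      · exact mem_coe.2 (mem_product.2 ((mem_bipartiteBelow _).1 hp).2)
      · rintro ⟨a, b⟩ - ⟨c, d⟩ - h
        simpa using h
  calc _ ≤ #P * (n - 2 - #Z).choose m := Nat.mul_le_mul_right _ hPc
    _ ≤ _ := by rwa [mul_comm (_ ^ 2)]

/-- If every pair from `X × Y` is only contained in exceptional sets, up to a bounded set `Z`,
then a positive proportion of all sets is exceptional. -/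
theorem eventually_lt_card_of_pairs (m z : ℕ) {γ γ' : ℝ} (hγ : 0 < γ) (hγ' : 0 < γ') :
    ∃ ε > (0 : ℝ), ∀ᶠ n : ℕ in Filter.atTop, ∀ (X Y Z : Finset (Fin n))
      (𝒩 : Finset (Finset (Fin n))), (∀ T ∈ 𝒩, #T = m + 2) → #Z ≤ z → γ * n ≤ #X → γ' * n ≤ #Y →
      (∀ T : Finset (Fin n), #T = m + 2 → Disjoint T Z → ∀ u ∈ X, ∀ v ∈ Y, u ≠ v → u ∈ T →
        v ∈ T → T ∈ 𝒩) → ε * n ^ (m + 2) < #𝒩 := by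
  set D : ℝ := 2 ^ m * m.factorial with hD
  have hDpos : 0 < D := by positivity
  refine ⟨γ / 2 * (γ' / 2) / (2 * D * (m + 2) ^ 2), by positivity, ?_⟩
  filter_upwards [eventually_lt_mul_natCast (z + 1) (half_pos hγ),
    eventually_lt_mul_natCast (z + 1) (half_pos hγ'), Filter.eventually_ge_atTop (2 * (2 + z + m)),
    Filter.eventually_gt_atTop 0] with n hn₁ hn₂ hn₃ hn₄ X Y Z 𝒩 h𝒩 hZ hX hY h
  have hn : (0 : ℝ) < n := by exact_mod_cast hn₄
  have h1 := card_mul_choose_le_of_pairs X Y Z 𝒩 h𝒩 h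
  have hZ' : (#Z : ℝ) ≤ z := by exact_mod_cast hZ
  have hXZ : γ / 2 * n ≤ #(X \ Z) := by
    have h2 : #X ≤ #(X \ Z) + #Z := by have := le_card_sdiff Z X; omega
    have h3 : (#X : ℝ) ≤ #(X \ Z) + #Z := by exact_mod_cast h2
    linarith
  have hYZ : γ' / 2 * n ≤ (#(Y \ Z) - 1 : ℕ) := by
    have h2 : #Y ≤ (#(Y \ Z) - 1 : ℕ) + 1 + #Z := by have := le_card_sdiff Z Y; omega
    have h3 : (#Y : ℝ) ≤ (#(Y \ Z) - 1 : ℕ) + 1 + #Z := by exact_mod_cast h2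
    linarith
  have h4 : (n : ℝ) ^ m ≤ D * (n - 2 - #Z).choose m := by
    have := pow_le_mul_choose_sub (2 + #Z) m (n := n) (by omega)
    rwa [Nat.sub_add_eq] at this
  have h5 : (#(X \ Z) : ℝ) * (#(Y \ Z) - 1 : ℕ) * (n - 2 - #Z).choose m ≤ (m + 2) ^ 2 * #𝒩 := by
    exact_mod_cast h1
  have h6 : γ / 2 * n * (γ' / 2 * n) * n ^ m ≤ D * ((m + 2) ^ 2 * #𝒩) := by
    calc γ / 2 * n * (γ' / 2 * n) * n ^ m
        ≤ #(X \ Z) * (#(Y \ Z) - 1 : ℕ) * (D * (n - 2 - #Z).choose m) := by gcongr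
      _ = D * (#(X \ Z) * (#(Y \ Z) - 1 : ℕ) * (n - 2 - #Z).choose m) := by ring
      _ ≤ _ := by gcongr
  have h7 : 0 < γ / 2 * n * (γ' / 2 * n) * (n : ℝ) ^ m := by positivity
  rw [div_mul_eq_mul_div, div_lt_iff₀ (by positivity)]
  calc γ / 2 * (γ' / 2) * (n : ℝ) ^ (m + 2) = γ / 2 * n * (γ' / 2 * n) * n ^ m := by ring
    _ < 2 * (γ / 2 * n * (γ' / 2 * n) * n ^ m) := by linarith
    _ ≤ 2 * (D * ((m + 2) ^ 2 * #𝒩)) := by gcongr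
    _ = _ := by ring

/-- The sets with a list of fewer than `t` strong neighbours are rare in a nearly extremal
hypergraph. -/
theorem eventually_exists_strong_lists (m : ℕ) {t w : ℕ} {ε : ℝ} (ht : 1 ≤ t)
    (hw : 2 * (m + 3 + 1) * (2 * t + 2 + 1) = w) (hε : 0 < ε) :
    ∃ ε₀ > (0 : ℝ), ∀ᶠ n : ℕ in Filter.atTop, ∀ H : Finset (Finset (Fin n)),
      (∀ e ∈ H, #e = m + 3) → LinearPathFree (m + 3) (2 * t + 2) H →
      (t * n.choose (m + 2) : ℝ) ≤ #H + ε₀ * n ^ (m + 2) →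
      ∃ L : Finset (Fin n) → Finset (Fin n),
        (∀ T, #T = m + 2 → L T ⊆ coneighbors H T ∧ #(L T) ≤ t ∧
          ∀ v ∈ L T, ∀ u ∈ T, IsStrongPair H w u v) ∧
        (#{T ∈ powersetCard (m + 2) univ | #(L T) ≠ t} : ℝ) ≤ ε * n ^ (m + 2) := by
  refine ⟨ε / 4, by positivity, ?_⟩
  filter_upwards [eventually_card_coneighbors_le m ht
    (show 0 < ε / (2 * ((w + 1) * (m + 4))) by positivity)] with n hn H hH hfree hcard
  obtain ⟨L, hL, hsum⟩ := exists_strong_lists hH hfree hw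
  refine ⟨L, hL, ?_⟩
  have h1 : (#(thickSets H (m + 2) t) : ℝ) ≤ ε / (2 * ((w + 1) * (m + 4))) * n ^ (m + 2) :=
    hn H hH hfree
  have h2 : (w + 1) * (m + 4) * (#(thickSets H (m + 2) t) : ℝ) ≤ ε / 2 * n ^ (m + 2) := by
    calc (w + 1) * (m + 4) * (#(thickSets H (m + 2) t) : ℝ)
        ≤ (w + 1) * (m + 4) * (ε / (2 * ((w + 1) * (m + 4))) * n ^ (m + 2)) := by gcongr
      _ = _ := by field_simp
  have h3 : ∑ T ∈ powersetCard (m + 2) univ, #(L T) +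
      #{T ∈ powersetCard (m + 2) (univ : Finset (Fin n)) | #(L T) ≠ t} ≤
      t * n.choose (m + 2) := by
    rw [card_filter, ← sum_add_distrib]
    refine (sum_le_card_nsmul _ _ t fun T hT => ?_).trans (by simp [mul_comm])
    have := (hL T (mem_powersetCard.1 hT).2).2.1
    split_ifs with h <;> omega
  have h4 : ∑ T ∈ powersetCard (m + 2) univ, (#(L T) : ℝ) +
      #{T ∈ powersetCard (m + 2) (univ : Finset (Fin n)) | #(L T) ≠ t} ≤
      t * n.choose (m + 2) := by exact_mod_cast h3
  linarith

/-- Stability: in a nearly extremal hypergraph, there is a `t`-set `S` such that almost all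
`(k - 1)`-sets form an edge with every vertex of `S`. -/
theorem eventually_exists_stable_set (m : ℕ) {t : ℕ} {ε : ℝ} (ht : 1 ≤ t) (hε : 0 < ε) :
    ∃ ε₀ > (0 : ℝ), ∀ᶠ n : ℕ in Filter.atTop, ∀ H : Finset (Finset (Fin n)),
      (∀ e ∈ H, #e = m + 3) → LinearPathFree (m + 3) (2 * t + 2) H →
      (t * n.choose (m + 2) : ℝ) ≤ #H + ε₀ * n ^ (m + 2) →
      ∃ S : Finset (Fin n), #S = t ∧
        (#{T ∈ powersetCard (m + 2) univ | ¬(Disjoint T S ∧ ∀ s ∈ S, insert s T ∈ H)} : ℝ) ≤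
          ε * n ^ (m + 2) := by
  obtain ⟨w, hw⟩ : ∃ w, 2 * (m + 3 + 1) * (2 * t + 2 + 1) = w := ⟨_, rfl⟩
  set D : ℝ := 2 ^ (m + 2) * (m + 2).factorial with hD
  have hDpos : 0 < D := by positivity
  obtain ⟨γ, hγ, hev⟩ := exists_popular_full_list m ht hw.le
    (show 0 < 1 / (2 * D) by positivity)
  obtain ⟨γ', hγ', hev'⟩ := exists_popular_full_list m ht hw.le (half_pos hε)
  obtain ⟨ε₁, hε₁, hpairs⟩ := eventually_lt_card_of_pairs m (2 * t) hγ hγ'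
  have hε₂ : 0 < min (min (1 / (2 * D)) (ε / 2)) ε₁ := by positivity
  obtain ⟨ε₀, hε₀, hlists⟩ := eventually_exists_strong_lists m ht hw hε₂
  refine ⟨ε₀, hε₀, ?_⟩
  filter_upwards [hev, hev', hpairs, hlists, eventually_lt_mul_natCast w hγ,
    eventually_lt_mul_natCast w hγ',
    Filter.eventually_ge_atTop (2 * (0 + (m + 2)))] with n hn hn' hpair hlist hγn hγn' hnm
      H hH hfree hcard
  obtain ⟨L, hL, hnon⟩ := hlist H hH hfree hcard
  set 𝒩 : Finset (Finset (Fin n)) := {T ∈ powersetCard (m + 2) univ | #(L T) ≠ t} with h𝒩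
  set 𝒢 : Finset (Finset (Fin n)) := {T ∈ powersetCard (m + 2) univ | #(L T) = t} with h𝒢
  have hnon₁ : (#𝒩 : ℝ) ≤ 1 / (2 * D) * n ^ (m + 2) := hnon.trans (by
    gcongr; exact (min_le_left _ _).trans (min_le_left _ _))
  have hnon₂ : (#𝒩 : ℝ) ≤ ε / 2 * n ^ (m + 2) := hnon.trans (by
    gcongr; exact (min_le_left _ _).trans (min_le_right _ _))
  have hnon₃ : (#𝒩 : ℝ) ≤ ε₁ * n ^ (m + 2) := hnon.trans (by gcongr; exact min_le_right _ _)
  have h𝒢L : ∀ T ∈ 𝒢, #T = m + 2 ∧ #(L T) = t ∧ L T ⊆ coneighbors H T ∧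
      ∀ v ∈ L T, ∀ u ∈ T, IsStrongPair H w u v := fun T hT => by
    obtain ⟨h1, h2⟩ := mem_filter.1 hT
    have h3 := (mem_powersetCard.1 h1).2
    exact ⟨h3, h2, (hL T h3).1, (hL T h3).2.2⟩
  have hdisj : ∀ T, #T = m + 2 → Disjoint (L T) T := fun T hT => disjoint_left.2 fun v hv =>
    (mem_coneighbors.1 ((hL T hT).1 hv)).1
  have h𝒢c : 1 / (2 * D) * n ^ (m + 2) ≤ (#𝒢 : ℝ) := by
    have h1 : #𝒢 + #𝒩 = n.choose (m + 2) := by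
      rw [h𝒢, h𝒩, card_filter_add_card_filter_not, card_powersetCard, card_univ, Fintype.card_fin]
    have h2 : (#𝒢 : ℝ) + #𝒩 = n.choose (m + 2) := by exact_mod_cast h1
    have h3 := pow_le_mul_choose_sub 0 (m + 2) hnm
    rw [Nat.sub_zero, ← hD, ← h2] at h3
    have h4 : 1 / (2 * D) * (n : ℝ) ^ (m + 2) ≤ 1 / (2 * D) * (D * (#𝒢 + #𝒩)) := by gcongr
    have h5 : 1 / (2 * D) * (D * ((#𝒢 : ℝ) + #𝒩)) = (#𝒢 + #𝒩) / 2 := by field_simp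
    linarith
  obtain ⟨S, X, hSt, hX, hSX, hs, -⟩ := hn H hH hfree 𝒢 L h𝒢L h𝒢c
  have hXw : w < #X := by exact_mod_cast hγn.trans_le hX
  refine ⟨S, hSt, ?_⟩
  have hbad : {T ∈ powersetCard (m + 2) (univ : Finset (Fin n)) |
      ¬(Disjoint T S ∧ ∀ s ∈ S, insert s T ∈ H)} ⊆
      𝒩 ∪ {T ∈ 𝒢 | L T ≠ S} := by
    intro T hT
    obtain ⟨hT₁, hne⟩ := mem_filter.1 hT
    by_cases h : #(L T) = t
    · refine mem_union_right _ (mem_filter.2 ⟨mem_filter.2 ⟨hT₁, h⟩, ?_⟩)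
      rintro rfl
      have hT' := (mem_powersetCard.1 hT₁).2
      exact hne ⟨(hdisj T hT').symm, fun s hs => (mem_coneighbors.1 ((hL T hT').1 hs)).2⟩
    · exact mem_union_left _ (mem_filter.2 ⟨hT₁, h⟩)
  have hother : (#{T ∈ 𝒢 | L T ≠ S} : ℝ) ≤ ε / 2 * n ^ (m + 2) := by
    by_contra! hlt
    obtain ⟨S', X', hSt', hX', hSX', hs', T', hT', rfl⟩ := hn' H hH hfree {T ∈ 𝒢 | L T ≠ S} L
      (fun T hT => h𝒢L T (mem_filter.1 hT).1) hlt.le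
    have hXw' : w < #X' := by exact_mod_cast hγn'.trans_le hX'
    refine absurd hnon₃ (not_le.2 (hpair X X' (S ∪ L T') 𝒩
      (fun T hT => (mem_powersetCard.1 (mem_filter.1 hT).1).2)
      ((card_union_le _ _).trans (by omega)) hX hX' fun T hT hTZ u hu v hv _ huT hvT => ?_))
    by_contra hTn
    have hT𝒢 : #(L T) = t := by
      by_contra h
      exact hTn (mem_filter.2 ⟨mem_powersetCard.2 ⟨subset_univ _, hT⟩, h⟩)
    rw [disjoint_union_right] at hTZ
    have h1 := hfree.eq_of_strong_list hH ht hw.le hSt hT𝒢 hXw hSX hs (by omega) (hdisj T hT)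
      hTZ.1.symm (hL T hT).2.2 huT hu
    have h2 := hfree.eq_of_strong_list hH ht hw.le hSt' hT𝒢 hXw' hSX' hs' (by omega) (hdisj T hT)
      hTZ.2.symm (hL T hT).2.2 hvT hv
    exact (mem_filter.1 hT').2 (h2.symm.trans h1)
  have h1 : (#({T ∈ powersetCard (m + 2) univ | ¬(Disjoint T S ∧ ∀ s ∈ S, insert s T ∈ H)}) : ℝ) ≤
      #𝒩 + #{T ∈ 𝒢 | L T ≠ S} := by
    exact_mod_cast (card_le_card hbad).trans (card_union_le _ _)
  linarith

theorem sum_choose_sub_add_choose {n t : ℕ} (j : ℕ) (ht : t ≤ n) :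
    ∑ i ∈ Icc 1 t, (n - i).choose j + (n - t).choose (j + 1) = n.choose (j + 1) := by
  induction t with
  | zero => simp
  | succ t ih =>
    rw [← ih (by omega), sum_Icc_succ_top (by omega), show n - t = n - (t + 1) + 1 by omega,
      Nat.choose_succ_succ]
    ring

theorem choose_le_choose_sub_add {n t : ℕ} (j : ℕ) (ht : t ≤ n) :
    n.choose (j + 1) ≤ (n - t).choose (j + 1) + t * n ^ j := by
  rw [← sum_choose_sub_add_choose j ht, add_comm]
  gcongr
  refine (sum_le_card_nsmul _ _ (n ^ j) fun i _ => ?_).trans (by simp)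
  exact (Nat.choose_le_pow _ _).trans (Nat.pow_le_pow_left (Nat.sub_le _ _) _)

/-- The number of edges that contain three vertices of a bounded set is small. -/
theorem card_le_of_three_le_card_inter {n m : ℕ} {F : Finset (Finset (Fin n))}
    (Z : Finset (Fin n)) (hF : ∀ e ∈ F, #e = m + 3 ∧ 3 ≤ #(e ∩ Z)) : #F ≤ #Z ^ 3 * n ^ m := by
  have hsub : F ⊆ (powersetCard 3 Z).biUnion fun P => {e ∈ F | P ⊆ e} := fun e he => by
    obtain ⟨P, hP, hPc⟩ := exists_subset_card_eq (hF e he).2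
    rw [subset_inter_iff] at hP
    exact mem_biUnion.2 ⟨P, mem_powersetCard.2 ⟨hP.2, hPc⟩, mem_filter.2 ⟨he, hP.1⟩⟩
  refine (card_le_card hsub).trans ((card_biUnion_le_card_mul _ _ (n ^ m) fun P hP => ?_).trans ?_)
  · have h := card_le_pow_of_superset (m := m + 3) (F := {e ∈ F | P ⊆ e}) P fun e he =>
      ⟨(hF e (mem_filter.1 he).1).1, (mem_filter.1 he).2⟩
    rwa [(mem_powersetCard.1 hP).2, Nat.add_sub_cancel] at h
  · rw [card_powersetCard]
    exact Nat.mul_le_mul_right _ (Nat.choose_le_pow _ _)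

/-- A `2`-intersecting family is a star with a core of two vertices, or small. -/
theorem exists_pair_or_card_le_of_two_le_card_inter {n m : ℕ} {G : Finset (Finset (Fin n))}
    (hG : ∀ e ∈ G, #e = m + 3) (h2 : ∀ e ∈ G, ∀ e' ∈ G, 2 ≤ #(e ∩ e')) :
    (∃ e₁ ∈ G, ∃ x ∈ e₁, ∃ y ∈ e₁, x ≠ y ∧ ∀ e ∈ G, x ∈ e ∧ y ∈ e) ∨
      #G ≤ (m + 3) ^ 3 * n ^ m := by
  rcases G.eq_empty_or_nonempty with rfl | ⟨e₁, he₁⟩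
  · simp
  refine or_iff_not_imp_left.2 fun hno => ?_
  have hex : ∀ P ∈ powersetCard 2 e₁, ∃ e ∈ G, ¬P ⊆ e := by
    intro P hP
    obtain ⟨hPe, hPc⟩ := mem_powersetCard.1 hP
    obtain ⟨x, y, hxy, rfl⟩ := card_eq_two.1 hPc
    by_contra! h
    simp only [insert_subset_iff, singleton_subset_iff] at hPe h
    exact hno ⟨e₁, he₁, x, hPe.1, y, hPe.2, hxy, h⟩
  choose! g hgG hg using hex
  have hsub : G ⊆ (powersetCard 2 e₁).biUnion fun P => {e ∈ G | P ⊆ e} := fun e he => by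
    obtain ⟨P, hP, hPc⟩ := exists_subset_card_eq (h2 e he e₁ he₁)
    rw [subset_inter_iff] at hP
    exact mem_biUnion.2 ⟨P, mem_powersetCard.2 ⟨hP.2, hPc⟩, mem_filter.2 ⟨he, hP.1⟩⟩
  refine (card_le_card hsub).trans
    ((card_biUnion_le_card_mul _ _ ((m + 3) * n ^ m) fun P hP => ?_).trans ?_)
  · have hPc := (mem_powersetCard.1 hP).2
    have h := card_le_mul_pow_of_meets (m := m + 3) (F := {e ∈ G | P ⊆ e}) P (g P) fun e he => by
      obtain ⟨heG, hPe⟩ := mem_filter.1 he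
      refine ⟨hG e heG, hPe, ?_⟩
      by_contra! h
      have hs : e ∩ g P ⊆ P := fun z hz => by
        by_contra hzP
        exact h z (mem_inter.1 hz).2 hzP (mem_inter.1 hz).1
      have heq := eq_of_subset_of_card_le hs (by rw [hPc]; exact h2 e heG _ (hgG P hP))
      exact hg P hP (heq.symm.subset.trans inter_subset_right)
    rwa [hPc, hG _ (hgG P hP), show m + 3 - (2 + 1) = m by omega] at h
  · rw [card_powersetCard, hG e₁ he₁, pow_succ, mul_assoc]
    exact Nat.mul_le_mul_right _ (Nat.choose_le_pow _ _)

/-- A family whose members meeting `R` cannot be disjoint, nor intersect in a single vertex with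
another vertex in `R`, is a star with a core of two vertices, or small. -/
theorem exists_pair_or_card_le {n m : ℕ} {G : Finset (Finset (Fin n))} {R Q : Finset (Fin n)}
    (hG : ∀ e ∈ G, #e = m + 3) (hGQ : ∀ e ∈ G, ∀ u ∈ e, u ∉ R → u ∈ Q)
    (hR : ∀ e ∈ G, ∃ u ∈ e, u ∈ R)
    (h₀ : ∀ e ∈ G, ∀ e' ∈ G, ¬Disjoint e e')
    (h₁ : ∀ e ∈ G, ∀ e' ∈ G, ∀ x, e ∩ e' = {x} → ∀ u ∈ e, u ≠ x → u ∉ R) :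
    (∃ e₁ ∈ G, ∃ x ∈ e₁, ∃ y ∈ e₁, x ≠ y ∧ ∀ e ∈ G, x ∈ e ∧ y ∈ e) ∨
      #G ≤ #Q ^ (m + 2) + (2 * (m + 3)) ^ 3 * n ^ m := by
  have h2 : ∀ e ∈ G, ∀ e' ∈ G, ∀ r ∈ e, r ∈ R → r ∉ e' → 2 ≤ #(e ∩ e') := by
    intro e he e' he' r hr hrR hre'
    by_contra! hlt
    rcases Nat.lt_or_ge 0 #(e ∩ e') with h | h
    · obtain ⟨x, hx⟩ := card_eq_one.1 (by omega : #(e ∩ e') = 1)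
      have hx' : x ∈ e ∩ e' := by simp [hx]
      exact h₁ e he e' he' x hx r hr (fun h => hre' (h ▸ (mem_inter.1 hx').2)) hrR
    · exact h₀ e he e' he' (disjoint_iff_inter_eq_empty.2 (card_eq_zero.1 (by omega)))
  by_cases hall : ∀ e ∈ G, ∀ e' ∈ G, 2 ≤ #(e ∩ e')
  · refine (exists_pair_or_card_le_of_two_le_card_inter hG hall).imp id fun h => h.trans ?_
    refine le_add_left (Nat.mul_le_mul_right _ (Nat.pow_le_pow_left (by omega) _))
  · push Not at hall
    obtain ⟨e, he, e', he', hlt⟩ := hall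
    have hone : #(e ∩ e') = 1 := by
      have : #(e ∩ e') ≠ 0 := fun h => h₀ e he e' he'
        (disjoint_iff_inter_eq_empty.2 (card_eq_zero.1 h))
      omega
    obtain ⟨x, hx⟩ := card_eq_one.1 hone
    have hxe := h₁ e he e' he' x hx
    have hxe' := h₁ e' he' e he x (by rw [inter_comm, hx])
    refine Or.inr ?_
    have hclass : G ⊆ {f ∈ G | x ∈ f ∧ f.erase x ⊆ Q} ∪ {f ∈ G | 3 ≤ #(f ∩ (e ∪ e'))} := by
      intro f hf
      by_cases h : ∃ r ∈ f, r ∈ R ∧ r ≠ x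
      · obtain ⟨r, hrf, hrR, hrx⟩ := h
        have a1 := h2 f hf e he r hrf hrR fun h => hxe r h hrx hrR
        have a2 := h2 f hf e' he' r hrf hrR fun h => hxe' r h hrx hrR
        have a3 := card_union_add_card_inter (f ∩ e) (f ∩ e')
        have a4 : #(f ∩ e ∩ (f ∩ e')) ≤ #(e ∩ e') :=
          card_le_card (inter_subset_inter inter_subset_right inter_subset_right)
        rw [← inter_union_distrib_left] at a3
        exact mem_union_right _ (mem_filter.2 ⟨hf, by omega⟩)
      · push Not at h
        obtain ⟨u, huf, huR⟩ := hR f hf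
        refine mem_union_left _ (mem_filter.2 ⟨hf, h u huf huR ▸ huf, fun v hv => ?_⟩)
        obtain ⟨hvx, hvf⟩ := mem_erase.1 hv
        exact hGQ f hf v hvf fun hvR => hvx (h v hvf hvR)
    refine (card_le_card hclass).trans ((card_union_le _ _).trans (add_le_add ?_ ?_))
    · refine (card_le_card_of_injOn (t := powersetCard (m + 2) Q) (fun f => f.erase x)
        (fun f hf => ?_) ?_).trans (by rw [card_powersetCard]; exact Nat.choose_le_pow _ _)
      · obtain ⟨hfG, hxf, hfQ⟩ := mem_filter.1 hf
        exact mem_coe.2 (mem_powersetCard.2 ⟨hfQ, by rw [card_erase_of_mem hxf, hG f hfG]; omega⟩)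
      · intro f hf f' hf' (heq : f.erase x = f'.erase x)
        rw [← insert_erase (mem_filter.1 hf).2.1, heq, insert_erase (mem_filter.1 hf').2.1]
    · refine (card_le_of_three_le_card_inter (e ∪ e') fun f hf =>
        ⟨hG f (mem_filter.1 hf).1, (mem_filter.1 hf).2⟩).trans ?_
      refine Nat.mul_le_mul_right _ (Nat.pow_le_pow_left ((card_union_le _ _).trans ?_) _)
      rw [hG e he, hG e' he']
      omega

/-- A vertex in few exceptional sets is strongly paired with every vertex of `S`. -/
theorem isStrongPair_of_card_filter_lt {n m t w : ℕ} {H : Finset (Finset (Fin n))}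
    {S : Finset (Fin n)} (hS : #S = t) (hn : 2 * (1 + t + w + (m + 1)) ≤ n) {u s : Fin n}
    (hu : u ∉ S) (hs : s ∈ S)
    (hbad : (#{T ∈ powersetCard (m + 2) univ |
      (Disjoint T S ∧ ∃ s ∈ S, insert s T ∉ H) ∧ u ∈ T} : ℝ) <
        1 / (2 * (2 ^ (m + 1) * (m + 1).factorial)) * n ^ (m + 1)) :
    IsStrongPair H w u s := by
  intro W hW huW hsW
  have hWS : #(S ∪ W) ≤ t + w := (card_union_le _ _).trans (by omega)
  have h1 := card_filter_superset_disjoint (m + 2) {u} (S ∪ W) (by simp [hu, huW]) (by simp)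
  rw [card_singleton, show m + 2 - 1 = m + 1 by omega, ← Nat.sub_add_eq] at h1
  have h2 := pow_le_mul_choose_sub (1 + #(S ∪ W)) (m + 1) (n := n) (by omega)
  rw [← h1] at h2
  have hpos : (0 : ℝ) < n ^ (m + 1) := by
    have : 0 < n := by omega
    positivity
  have hlt : #{T ∈ powersetCard (m + 2) univ | (Disjoint T S ∧ ∃ s ∈ S, insert s T ∉ H) ∧ u ∈ T} <
      #{T ∈ powersetCard (m + 2) (univ : Finset (Fin n)) | {u} ⊆ T ∧ Disjoint T (S ∪ W)} := by
    rw [← Nat.cast_lt (α := ℝ)]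
    refine hbad.trans_le ?_
    rw [div_mul_eq_mul_div, one_mul, div_le_iff₀ (by positivity)]
    linarith
  obtain ⟨T, hT, hTb⟩ := exists_mem_notMem_of_card_lt_card hlt
  obtain ⟨hTc, huT, hTd⟩ := mem_filter.1 hT
  rw [disjoint_union_right] at hTd
  rw [singleton_subset_iff] at huT
  refine ⟨insert s T, ?_, by simp [huT], by simp, by simp [hsW, hTd.2]⟩
  by_contra h
  exact hTb (mem_filter.2 ⟨hTc, ⟨hTd.1, s, hs, h⟩, huT⟩)

theorem card_filter_not_disjoint_add_choose {n k t : ℕ} {S : Finset (Fin n)} (hS : #S = t) :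
    #{e ∈ powersetCard k univ | ¬Disjoint e S} + (n - t).choose k = n.choose k := by
  have h1 := card_filter_superset_disjoint k ∅ S (disjoint_empty_left _) (by simp)
  simp only [empty_subset, true_and, card_empty, Nat.sub_zero, hS] at h1
  have h2 := card_filter_add_card_filter_not (s := powersetCard k (univ : Finset (Fin n)))
    (fun e => Disjoint e S)
  rw [h1, card_powersetCard, card_univ, Fintype.card_fin] at h2
  omega

/-- In an extremal hypergraph, the missing edges that meet `S` are compensated by edges that avoid
`S`. -/
theorem card_filter_disjoint_eq_of_card_eq {n m t : ℕ} {H : Finset (Finset (Fin n))}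
    (hH : ∀ e ∈ H, #e = m + 3)
    (hcard : #H = ∑ i ∈ Icc 1 t, (n - i).choose (m + 2) + (n - t - 2).choose (m + 1))
    {S : Finset (Fin n)} (hS : #S = t) :
    #{e ∈ H | Disjoint e S} =
      #{e ∈ powersetCard (m + 3) univ | ¬Disjoint e S ∧ e ∉ H} + (n - t - 2).choose (m + 1) := by
  have htn : t ≤ n := hS ▸ card_finset_fin_le S
  have h1 := sum_choose_sub_add_choose (m + 2) htn
  change _ + (n - t).choose (m + 3) = n.choose (m + 3) at h1
  have h2 := card_filter_not_disjoint_add_choose (k := m + 3) hS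
  have h3 := card_filter_add_card_filter_not (s := H) (fun e => Disjoint e S)
  have h4 := card_filter_add_card_filter_not
    (s := {e ∈ powersetCard (m + 3) univ | ¬Disjoint e S}) (fun e => e ∈ H)
  rw [filter_filter, filter_filter] at h4
  have h5 : {e ∈ powersetCard (m + 3) (univ : Finset (Fin n)) | ¬Disjoint e S ∧ e ∈ H} =
      {e ∈ H | ¬Disjoint e S} := by
    ext e
    simp only [mem_filter, mem_powersetCard, subset_univ, true_and]
    exact ⟨fun h => ⟨h.2.2, h.2.1⟩, fun h => ⟨hH e h.1, h.2, h.1⟩⟩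
  rw [h5] at h4
  omega

theorem card_filter_pair_subset {n m t : ℕ} {S : Finset (Fin n)} {x y : Fin n} (hS : #S = t)
    (hx : x ∉ S) (hy : y ∉ S) (hxy : x ≠ y) :
    #{e ∈ powersetCard (m + 3) univ | {x, y} ⊆ e ∧ Disjoint e S} =
      (n - t - 2).choose (m + 1) := by
  rw [card_filter_superset_disjoint (m + 3) {x, y} S (by simp [hx, hy])
    (by rw [card_pair hxy]; omega), card_pair hxy, hS, Nat.sub_sub, Nat.sub_sub, add_comm 2 t]
  rfl

/-- A hypergraph containing all edges that meet `S`, all of whose other edges contain `x` and `y`,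
is determined by the number of these other edges. -/
theorem mem_iff_of_card_filter_disjoint_eq {n m t : ℕ} {H : Finset (Finset (Fin n))}
    (hH : ∀ e ∈ H, #e = m + 3) {S : Finset (Fin n)} {x y : Fin n} (hS : #S = t) (hx : x ∉ S)
    (hy : y ∉ S) (hxy : x ≠ y) (hxyH : ∀ e ∈ H, Disjoint e S → x ∈ e ∧ y ∈ e)
    (hcard : #{e ∈ H | Disjoint e S} = (n - t - 2).choose (m + 1))
    (hall : ∀ e : Finset (Fin n), #e = m + 3 → ¬Disjoint e S → e ∈ H) (e : Finset (Fin n)) :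
    e ∈ H ↔ #e = m + 3 ∧ ((e ∩ S).Nonempty ∨ (Disjoint e S ∧ x ∈ e ∧ y ∈ e)) := by
  have hsub : {e ∈ H | Disjoint e S} ⊆
      {e ∈ powersetCard (m + 3) (univ : Finset (Fin n)) | {x, y} ⊆ e ∧ Disjoint e S} :=
      fun e he => by
    obtain ⟨h1, h2⟩ := mem_filter.1 he
    refine mem_filter.2 ⟨mem_powersetCard.2 ⟨subset_univ _, hH e h1⟩, ?_, h2⟩
    exact insert_subset (hxyH e h1 h2).1 (singleton_subset_iff.2 (hxyH e h1 h2).2)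
  have heq := eq_of_subset_of_card_le hsub (by rw [card_filter_pair_subset hS hx hy hxy, hcard])
  rw [← not_disjoint_iff_nonempty_inter]
  refine ⟨fun he => ⟨hH e he, ?_⟩, ?_⟩
  · by_cases hd : Disjoint e S
    · exact Or.inr ⟨hd, hxyH e he hd⟩
    · exact Or.inl hd
  · rintro ⟨hek, hd | ⟨hd, hxe, hye⟩⟩
    · exact hall e hek hd
    · have h1 : e ∈ {e ∈ H | Disjoint e S} := heq ▸ mem_filter.2 ⟨mem_powersetCard.2
        ⟨subset_univ _, hek⟩, insert_subset hxe (singleton_subset_iff.2 hye), hd⟩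
      exact (mem_filter.1 h1).1

/-- If almost all vertices are strongly paired with `S` and there are many missing edges through the
other vertices, an extremal hypergraph has the claimed structure. -/
theorem exists_pair_of_strong_vertices {n m t w : ℕ} {H : Finset (Finset (Fin n))}
    (ht : 1 ≤ t) (hH : ∀ e ∈ H, #e = m + 3) (hfree : LinearPathFree (m + 3) (2 * t + 2) H)
    (hw : 2 * (m + 3 + 1) * (2 * t + 2 + 1) = w)
    (hcard : #H = ∑ i ∈ Icc 1 t, (n - i).choose (m + 2) + (n - t - 2).choose (m + 1))
    {S R Q : Finset (Fin n)} (hS : #S = t) (hSR : Disjoint S R) (hRQ : ∀ u ∉ S, u ∉ R → u ∈ Q)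
    (hs : ∀ u ∈ R, ∀ s ∈ S, IsStrongPair H w u s) (hR : w < #R) {c η : ℝ} (hη : 0 < η)
    (hη₁ : η ≤ 1) (hηc : (w + 2) * η ≤ c) (hQ : #Q ≤ η * n)
    (hmiss : c * #Q * n ^ (m + 1) ≤
      #{e ∈ powersetCard (m + 3) univ | ¬Disjoint e S ∧ e ∉ H})
    (hlarge : (2 * (m + 3)) ^ 3 * n ^ m < (n - t - 2).choose (m + 1)) :
    ∃ x y : Fin n, x ∉ S ∧ y ∉ S ∧ x ≠ y ∧
      ∀ e, e ∈ H ↔ #e = m + 3 ∧ ((e ∩ S).Nonempty ∨ (Disjoint e S ∧ x ∈ e ∧ y ∈ e)) := by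
  set M : Finset (Finset (Fin n)) :=
    {e ∈ powersetCard (m + 3) univ | ¬Disjoint e S ∧ e ∉ H} with hM
  set G : Finset (Finset (Fin n)) := {e ∈ H | Disjoint e S} with hG
  set Ga : Finset (Finset (Fin n)) := {e ∈ G | ¬∃ u ∈ e, u ∈ R} with hGa
  set Gb : Finset (Finset (Fin n)) := {e ∈ G | ∃ u ∈ e, u ∈ R} with hGb
  have hGM : #G = #M + (n - t - 2).choose (m + 1) := card_filter_disjoint_eq_of_card_eq hH hcard hS
  have hGab : #Gb + #Ga = #G := card_filter_add_card_filter_not _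
  have hGQ : ∀ e ∈ G, ∀ u ∈ e, u ∉ R → u ∈ Q := fun e he u hu hR =>
    hRQ u (disjoint_left.1 (mem_filter.1 he).2 hu) hR
  have hn : (0 : ℝ) < n := by
    have : 0 < n := by
      have := card_finset_fin_le R
      omega
    exact_mod_cast this
  have hQpow : (#Q : ℝ) ^ (m + 2) ≤ η * (#Q * n ^ (m + 1)) := by
    calc (#Q : ℝ) ^ (m + 2) = #Q * #Q ^ (m + 1) := by ring
      _ ≤ #Q * (η * n) ^ (m + 1) := by gcongr
      _ = η ^ (m + 1) * (#Q * n ^ (m + 1)) := by ring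
      _ ≤ η * (#Q * n ^ (m + 1)) := by
        gcongr
        exact pow_le_of_le_one hη.le hη₁ (by omega)
  have hGaQ : (#Ga : ℝ) ≤ (w + 1) * #Q ^ (m + 2) := by
    have h1 := hfree.card_le_mul_shadow (F := Ga) (by omega) hH
      ((filter_subset _ _).trans (filter_subset _ _)) (powersetCard (m + 2) Q) (by
        intro e he z hz
        obtain ⟨heG, he⟩ := mem_filter.1 he
        push Not at he
        refine mem_powersetCard.2 ⟨fun u hu => hGQ e heG u (mem_of_mem_erase hu)
          (he u (mem_of_mem_erase hu)), ?_⟩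
        rw [card_erase_of_mem hz, hH e (mem_filter.1 heG).1]
        omega)
    rw [hw, card_powersetCard] at h1
    refine h1.trans ?_
    have h2 : ((#Q).choose (m + 2) : ℝ) ≤ #Q ^ (m + 2) := by
      exact_mod_cast Nat.choose_le_pow _ _
    gcongr
  have hMQ : (w + 2) * η * (#Q * n ^ (m + 1)) ≤ #M := by
    calc _ ≤ c * (#Q * n ^ (m + 1)) := by gcongr
      _ = c * #Q * n ^ (m + 1) := by ring
      _ ≤ _ := hmiss
  have hGaη : (#Ga : ℝ) ≤ (w + 1) * (η * (#Q * n ^ (m + 1))) := hGaQ.trans (by gcongr)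
  have hGbS : ∀ e ∈ Gb, e ∈ H ∧ Disjoint S e ∧ ∃ u ∈ e, u ∈ R := fun e he => by
    obtain ⟨h1, h2⟩ := mem_filter.1 he
    exact ⟨(mem_filter.1 h1).1, (mem_filter.1 h1).2.symm, h2⟩
  have hdich := exists_pair_or_card_le (G := Gb) (R := R) (Q := Q) (m := m)
    (fun e he => hH e (hGbS e he).1) (fun e he => hGQ e (mem_filter.1 he).1)
    (fun e he => (hGbS e he).2.2)
    (fun e he e' he' hd => by
      obtain ⟨heH, heS, u, hu, huR⟩ := hGbS e he
      obtain ⟨heH', heS', u', hu', huR'⟩ := hGbS e' he'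
      exact not_linearPathFree_of_disjoint_edges (by omega) ht hH hw.le hS hSR hs hR heH heH' heS
        heS' hd hu huR hu' huR' hfree)
    (fun e he e' he' x hx u hu hux huR => by
      obtain ⟨heH, heS, -⟩ := hGbS e he
      obtain ⟨heH', heS', -⟩ := hGbS e' he'
      obtain ⟨v, hv, hvx⟩ := exists_mem_ne (by rw [hH e' heH']; omega : 1 < #e') x
      exact not_linearPathFree_of_two_edges hH hw.le hS hSR hs hR heH' heH heS' heS
        (by rw [inter_comm, hx]) hv hvx hu hux huR hfree)
  rcases hdich with ⟨e₁, he₁, x, hx, y, hy, hxy, hall⟩ | hle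
  · have hxS : x ∉ S := disjoint_right.1 (hGbS e₁ he₁).2.1 hx
    have hyS : y ∉ S := disjoint_right.1 (hGbS e₁ he₁).2.1 hy
    have hGbP : Gb ⊆ {e ∈ powersetCard (m + 3) (univ : Finset (Fin n)) |
        {x, y} ⊆ e ∧ Disjoint e S} := fun e he => by
      obtain ⟨h1, h2, -⟩ := hGbS e he
      refine mem_filter.2 ⟨mem_powersetCard.2 ⟨subset_univ _, hH e h1⟩, ?_, h2.symm⟩
      exact insert_subset (hall e he).1 (singleton_subset_iff.2 (hall e he).2)
    have hle := card_le_card hGbP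
    rw [card_filter_pair_subset hS hxS hyS hxy] at hle
    have hMGa : #M ≤ #Ga := by omega
    have hMGa' : (#M : ℝ) ≤ #Ga := by exact_mod_cast hMGa
    have hQ0 : (#Q : ℝ) = 0 := by
      have h1 : η * (#Q * (n : ℝ) ^ (m + 1)) ≤ 0 := by linarith
      by_contra h
      have h3 : 0 < (#Q : ℝ) := lt_of_le_of_ne (Nat.cast_nonneg _) (Ne.symm h)
      exact absurd h1 (not_le.2 (by positivity))
    have hGa0 : #Ga = 0 := by
      rw [hQ0, zero_pow (by omega), mul_zero] at hGaQ
      exact_mod_cast le_antisymm hGaQ (Nat.cast_nonneg _)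
    have hM0 : #M = 0 := by omega
    have hGc : #G = (n - t - 2).choose (m + 1) := by omega
    refine ⟨x, y, hxS, hyS, hxy, mem_iff_of_card_filter_disjoint_eq hH hS hxS hyS hxy
      (fun e he hd => hall e ?_) hGc fun e he hd => ?_⟩
    · by_contra h
      have h1 : e ∈ Ga := mem_filter.2 ⟨mem_filter.2 ⟨he, hd⟩, fun h3 =>
        h (mem_filter.2 ⟨mem_filter.2 ⟨he, hd⟩, h3⟩)⟩
      rw [card_eq_zero.1 hGa0] at h1
      exact notMem_empty _ h1
    · by_contra h
      have h1 : e ∈ M := mem_filter.2 ⟨mem_powersetCard.2 ⟨subset_univ _, he⟩, hd, h⟩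
      rw [card_eq_zero.1 hM0] at h1
      exact notMem_empty _ h1
  · have h1 : (#Gb : ℝ) ≤ #Q ^ (m + 2) + (2 * (m + 3)) ^ 3 * n ^ m := by exact_mod_cast hle
    have h2 : (#Gb : ℝ) + #Ga = #M + (n - t - 2).choose (m + 1) := by
      exact_mod_cast hGab.trans hGM
    have h3 : ((2 * (m + 3)) ^ 3 * n ^ m : ℝ) < (n - t - 2).choose (m + 1) := by
      exact_mod_cast hlarge
    linarith

/-- Double counting of the vertices in many members of a family of `m`-sets. -/
theorem mul_card_filter_le_mul_card {n m : ℕ} (ℬ : Finset (Finset (Fin n)))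
    (hℬ : ∀ T ∈ ℬ, #T = m) (d : ℝ) :
    #{u | d ≤ #{T ∈ ℬ | u ∈ T}} * d ≤ m * #ℬ := by
  have h1 : ∑ u : Fin n, #{T ∈ ℬ | u ∈ T} = m * #ℬ := by
    have := sum_card_bipartiteAbove_eq_sum_card_bipartiteBelow
      (s := (univ : Finset (Fin n))) (t := ℬ) (fun u T => u ∈ T)
    simp only [bipartiteAbove, bipartiteBelow] at this
    rw [this, mul_comm, ← smul_eq_mul, ← sum_const]
    refine sum_congr rfl fun T hT => ?_
    rw [← hℬ T hT]
    congr 1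
    ext
    simp
  have h2 : (∑ u : Fin n, #{T ∈ ℬ | u ∈ T} : ℝ) = m * #ℬ := by exact_mod_cast h1
  rw [← h2, ← nsmul_eq_mul]
  refine (card_nsmul_le_sum _ (fun u => (#{T ∈ ℬ | u ∈ T} : ℝ)) d fun u hu =>
    (mem_filter.1 hu).2).trans ?_
  exact sum_le_sum_of_subset_of_nonneg (subset_univ _) fun _ _ _ => by positivity

/-- The extremal structure for large `n`, with the uniformity written as `m + 3`. -/
theorem eventually_exists_star_structure (m : ℕ) {t : ℕ} (ht : 1 ≤ t) :
    ∀ᶠ n : ℕ in Filter.atTop, ∀ H : Finset (Finset (Fin n)),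
      (∀ e ∈ H, #e = m + 3) → LinearPathFree (m + 3) (2 * t + 2) H →
      #H = ∑ i ∈ Icc 1 t, (n - i).choose (m + 2) + (n - t - 2).choose (m + 1) →
      ∃ (S : Finset (Fin n)) (x y : Fin n), #S = t ∧ x ∉ S ∧ y ∉ S ∧ x ≠ y ∧
        ∀ e, e ∈ H ↔ #e = m + 3 ∧ ((e ∩ S).Nonempty ∨ (Disjoint e S ∧ x ∈ e ∧ y ∈ e)) := by
  obtain ⟨w, hw⟩ : ∃ w, 2 * (m + 3 + 1) * (2 * t + 2 + 1) = w := ⟨_, rfl⟩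
  set D : ℝ := 2 ^ (m + 1) * (m + 1).factorial with hD
  have hDpos : 0 < D := by positivity
  set β : ℝ := 1 / (2 * D) with hβ
  have hβpos : 0 < β := by positivity
  set c : ℝ := β / (m + 2) with hc
  have hcpos : 0 < c := by positivity
  set η : ℝ := min (1 / 2) (c / (w + 2)) with hη
  have hηpos : 0 < η := by positivity
  have hη₁ : η ≤ 1 / 2 := min_le_left _ _
  have hηc : (w + 2) * η ≤ c := by
    calc (w + 2) * η ≤ (w + 2) * (c / (w + 2)) := by gcongr; exact min_le_right _ _
      _ = c := by field_simp
  obtain ⟨ε₀, hε₀, hstable⟩ := eventually_exists_stable_set m ht (mul_pos hηpos hcpos)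
  filter_upwards [hstable, eventually_lt_mul_natCast (t * t) hε₀,
    eventually_lt_mul_natCast (t + w) (show (0 : ℝ) < 1 / 2 by norm_num),
    eventually_lt_mul_natCast (D * (2 * (m + 3)) ^ 3) one_pos,
    Filter.eventually_ge_atTop (2 * (2 + t + w + (m + 1)))] with n hn hnε hnw hnD hnm H hH hfree
      hcard
  have hn0 : (0 : ℝ) < n := by
    have : 0 < n := by omega
    exact_mod_cast this
  have hHt : (t * n.choose (m + 2) : ℝ) ≤ #H + ε₀ * n ^ (m + 2) := by
    have h1 := choose_le_choose_sub_add (m + 1) (show t ≤ n by omega)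
    have h2 : t * (n - t).choose (m + 2) ≤ #H := by
      rw [hcard]
      refine le_add_right ?_
      have := card_nsmul_le_sum (Icc 1 t) (fun i => (n - i).choose (m + 2))
        ((n - t).choose (m + 2)) fun i hi => Nat.choose_le_choose _
          (Nat.sub_le_sub_left (mem_Icc.1 hi).2 _)
      simpa using this
    have h3 : t * n.choose (m + 2) ≤ #H + t * t * n ^ (m + 1) := by
      calc t * n.choose (m + 2) ≤ t * ((n - t).choose (m + 2) + t * n ^ (m + 1)) :=
            Nat.mul_le_mul_left _ h1
        _ = t * (n - t).choose (m + 2) + t * t * n ^ (m + 1) := by ring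
        _ ≤ _ := by gcongr
    have h4 : (t * n.choose (m + 2) : ℝ) ≤ #H + t * t * n ^ (m + 1) := by exact_mod_cast h3
    have h5 : (t * t * n ^ (m + 1) : ℝ) ≤ ε₀ * n ^ (m + 2) := by
      calc (t * t * n ^ (m + 1) : ℝ) ≤ ε₀ * n * n ^ (m + 1) := by gcongr
        _ = _ := by ring
    linarith
  obtain ⟨S, hS, hbad⟩ := hn H hH hfree hHt
  set ℬ : Finset (Finset (Fin n)) :=
    {T ∈ powersetCard (m + 2) univ | Disjoint T S ∧ ∃ s ∈ S, insert s T ∉ H} with hℬ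
  have hℬc : (#ℬ : ℝ) ≤ η * c * n ^ (m + 2) := by
    refine le_trans (Nat.cast_le.2 (card_le_card fun T hT => ?_)) hbad
    obtain ⟨h1, -, s, hs, h2⟩ := mem_filter.1 hT
    exact mem_filter.2 ⟨h1, fun h => h2 (h.2 s hs)⟩
  have hℬM : #ℬ ≤ #{e ∈ powersetCard (m + 3) univ | ¬Disjoint e S ∧ e ∉ H} := by
    refine (card_le_card fun T hT => mem_image.2 ?_).trans (card_image_le (f := fun e => e \ S))
    obtain ⟨h1, hd, s, hs, h2⟩ := mem_filter.1 hT
    have hsT : s ∉ T := disjoint_right.1 hd hs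
    refine ⟨insert s T, mem_filter.2 ⟨mem_powersetCard.2 ⟨subset_univ _, ?_⟩, ?_, h2⟩, ?_⟩
    · rw [card_insert_of_notMem hsT, (mem_powersetCard.1 h1).2]
    · exact fun h => disjoint_left.1 h (mem_insert_self _ _) hs
    · rw [insert_sdiff_of_mem _ hs, sdiff_eq_self_of_disjoint hd]
  set Q : Finset (Fin n) := {u | β * n ^ (m + 1) ≤ #{T ∈ ℬ | u ∈ T}} with hQ
  have hQℬ : c * #Q * n ^ (m + 1) ≤ (#ℬ : ℝ) := by
    have h1 := mul_card_filter_le_mul_card ℬ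
      (fun T hT => (mem_powersetCard.1 (mem_filter.1 hT).1).2) (β * n ^ (m + 1))
    rw [← hQ] at h1
    push_cast at h1
    rw [hc, div_mul_eq_mul_div, div_mul_eq_mul_div, div_le_iff₀ (by positivity)]
    linarith
  have hQη : (#Q : ℝ) ≤ η * n := by
    have h1 := hQℬ.trans hℬc
    refine le_of_mul_le_mul_left ?_ (show 0 < c * (n : ℝ) ^ (m + 1) by positivity)
    calc c * (n : ℝ) ^ (m + 1) * #Q = c * #Q * n ^ (m + 1) := by ring
      _ ≤ _ := h1
      _ = _ := by ring
  set R : Finset (Fin n) := univ \ (S ∪ Q) with hR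
  have hRw : w < #R := by
    have h1 : n ≤ #R + (t + #Q) := by
      have h1 := le_card_sdiff (S ∪ Q) univ
      have h2 := card_union_le S Q
      rw [← hR, card_univ, Fintype.card_fin] at h1
      omega
    have h2 : (n : ℝ) ≤ #R + (t + #Q) := by exact_mod_cast h1
    have h3 : η * n ≤ 1 / 2 * n := by gcongr
    have h4 : (w : ℝ) < #R := by linarith
    exact_mod_cast h4
  have hRm : ∀ u ∈ R, u ∉ S ∧ u ∉ Q := fun u hu => by simpa [hR] using hu
  have hstrong : ∀ u ∈ R, ∀ s ∈ S, IsStrongPair H w u s := by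
    intro u hu s hs
    obtain ⟨huS, huQ⟩ := hRm u hu
    refine isStrongPair_of_card_filter_lt (m := m) hS (by omega) huS hs ?_
    have h1 : (#{T ∈ ℬ | u ∈ T} : ℝ) < β * n ^ (m + 1) := by
      by_contra! h
      exact huQ (mem_filter.2 ⟨mem_univ _, h⟩)
    rwa [hℬ, filter_filter] at h1
  have hlarge : (2 * (m + 3)) ^ 3 * n ^ m < (n - t - 2).choose (m + 1) := by
    have h1 := pow_le_mul_choose_sub (t + 2) (m + 1) (n := n) (by omega)
    rw [← hD, Nat.sub_add_eq] at h1
    rw [one_mul] at hnD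
    have h2 : D * ((2 * (m + 3)) ^ 3 * (n : ℝ) ^ m) < D * ((n - t - 2).choose (m + 1) : ℝ) := by
      calc D * ((2 * (m + 3)) ^ 3 * (n : ℝ) ^ m) = D * (2 * (m + 3)) ^ 3 * (n : ℝ) ^ m := by ring
        _ < (n : ℝ) * n ^ m := by gcongr
        _ = (n : ℝ) ^ (m + 1) := by ring
        _ ≤ _ := h1
    have h3 := lt_of_mul_lt_mul_left h2 hDpos.le
    exact_mod_cast h3
  obtain ⟨x, y, hxS, hyS, hxy, hxyH⟩ := exists_pair_of_strong_vertices ht hH hfree hw hcard hS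
    (disjoint_right.2 fun u hu => (hRm u hu).1)
    (fun u hu hu' => by
      by_contra h
      exact hu' (mem_sdiff.2 ⟨mem_univ _, by simp [hu, h]⟩))
    hstrong hRw hηpos (hη₁.trans (by norm_num)) hηc hQη
    (hQℬ.trans (by exact_mod_cast hℬM)) hlarge
  exact ⟨S, x, y, hS, hxS, hyS, hxy, hxyH⟩

end LinearPaths

/-- Theorem 1, even case, extremal structure: for `k ≥ 3` and sufficiently large `n`, any
extremal `k`-uniform hypergraph with no linear path of length `2t+2` consists of all
`k`-sets meeting a fixed `t`-set `S`, plus all `k`-sets disjoint from `S` containing two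
fixed elements `x, y ∉ S`. -/
theorem extremal_linear_path_even (k t : ℕ) (hk : 3 ≤ k) (ht : 1 ≤ t) :
    ∃ n₀ : ℕ, ∀ n ≥ n₀, ∀ H : Finset (Finset (Fin n)),
      (∀ e ∈ H, e.card = k) →
      H.card = (∑ i ∈ Finset.Icc 1 t, Nat.choose (n - i) (k - 1)) +
        Nat.choose (n - t - 2) (k - 2) →
      (¬ ∃ A : Fin (2 * t + 2) → Finset (Fin n),
          IsLinearPath k (2 * t + 2) A ∧ ∀ i, A i ∈ H) →
      ∃ (S : Finset (Fin n)) (x y : Fin n), S.card = t ∧ x ∉ S ∧ y ∉ S ∧ x ≠ y ∧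
        ∀ e : Finset (Fin n), e ∈ H ↔
          e.card = k ∧ ((e ∩ S).Nonempty ∨ (Disjoint e S ∧ x ∈ e ∧ y ∈ e)) := by
  obtain ⟨m, rfl⟩ : ∃ m, k = m + 3 := ⟨k - 3, by omega⟩
  obtain ⟨n₀, hn₀⟩ := Filter.eventually_atTop.1 (eventually_exists_star_structure m ht)
  refine ⟨n₀, fun n hn H hH hcard hfree => ?_⟩
  obtain ⟨S, x, y, hS, hx, hy, hxy, h⟩ := hn₀ n hn H hH hfree hcard
  refine ⟨S, x, y, hS, hx, hy, hxy, fun e => (h e).trans ?_⟩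
  convert Iff.rfl
end

section
/- Let k ≥ 3 and let H be a k-uniform hypergraph on n vertices such that no two edges of H intersect in exactly one vertex. Then H has at most C(n, k−2) edges. -/
/-- Summing the number of `j`-subsets of `A ∩ S` over the `i`-subsets `S` of `B` counts every
`j`-subset of `A ∩ B` the same number of times. -/
theorem Finset.sum_powersetCard_choose_card_inter {α : Type*} [DecidableEq α] (A B : Finset α)
    {i j : ℕ} (hj : j ≤ i) :
    ∑ S ∈ B.powersetCard i, (A ∩ S).card.choose j =
      (A ∩ B).card.choose j * (B.card - j).choose (i - j) := by
  have hS : ∀ S ∈ B.powersetCard i, (A ∩ S).card.choose j =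
      (((A ∩ B).powersetCard j).bipartiteAbove (fun S T ↦ T ⊆ S) S).card := by
    intro S hS
    rw [← Finset.card_powersetCard]
    congr 1
    ext T
    have := (Finset.mem_powersetCard.1 hS).1
    simp only [Finset.mem_powersetCard, Finset.mem_bipartiteAbove, Finset.subset_inter_iff]
    constructor
    · rintro ⟨⟨hA, hTS⟩, hc⟩
      exact ⟨⟨⟨hA, hTS.trans this⟩, hc⟩, hTS⟩
    · rintro ⟨⟨⟨hA, -⟩, hc⟩, hTS⟩
      exact ⟨⟨hA, hTS⟩, hc⟩
  rw [Finset.sum_congr rfl hS, Finset.sum_card_bipartiteAbove_eq_sum_card_bipartiteBelow,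
    Finset.sum_congr rfl (g := fun _ ↦ (B.card - j).choose (i - j)), Finset.sum_const,
    Finset.card_powersetCard, smul_eq_mul]
  intro T hT
  obtain ⟨hTB, rfl⟩ := Finset.mem_powersetCard.1 hT
  exact Finset.card_filter_powersetCard_subset _ _ _ (hTB.trans Finset.inter_subset_right) hj

/-- An integer matrix congruent to the identity modulo some `p > 1` has nonzero determinant. -/
theorem Matrix.det_ne_zero_of_map_zmod_eq_one {ι : Type*} [Fintype ι] [DecidableEq ι] {p : ℕ}
    [Nontrivial (ZMod p)] {M : Matrix ι ι ℤ} (hM : M.map (Int.castRingHom (ZMod p)) = 1) :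
    M.det ≠ 0 := by
  intro h
  have := (Int.castRingHom (ZMod p)).map_det M
  rw [h, RingHom.mapMatrix_apply, hM, Matrix.det_one, map_zero] at this
  exact zero_ne_one this

/-- For `k`-sets `B`, the shifted binomial coefficient of `#(A ∩ B)` is a combination of the
indicators `S ⊆ B` of `m`-sets `S`, with coefficients depending only on `A` and `S`. -/
theorem Finset.exists_sum_powersetCard_eq_ringChoose {α : Type*} [DecidableEq α] {k m : ℕ}
    (hmk : m ≤ k) (r : ℤ) (A : Finset α) :
    ∃ f : Finset α → ℚ, ∀ B : Finset α, B.card = k →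
      ∑ S ∈ B.powersetCard m, f S = (Ring.choose (((A ∩ B).card : ℤ) + r) m : ℤ) := by
  refine ⟨fun S ↦ ∑ ij ∈ Finset.HasAntidiagonal.antidiagonal m,
    ((Ring.choose r ij.2 : ℤ) : ℚ) / ((k - ij.1).choose (m - ij.1) : ℚ) *
      ((A ∩ S).card.choose ij.1 : ℚ), fun B hB ↦ ?_⟩
  rw [Finset.sum_comm, Ring.add_choose_eq m (Commute.all _ _), Int.cast_sum]
  refine Finset.sum_congr rfl fun ij hij ↦ ?_
  have hj : ij.1 ≤ m := Finset.HasAntidiagonal.antidiagonal.fst_le hij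
  have hpos : ((k - ij.1).choose (m - ij.1) : ℚ) ≠ 0 :=
    Nat.cast_ne_zero.2 (Nat.choose_pos (Nat.sub_le_sub_right hmk _)).ne'
  rw [← Finset.mul_sum, ← Nat.cast_sum, Finset.sum_powersetCard_choose_card_inter A B hj, hB,
    Ring.choose_natCast]
  push_cast
  field_simp

theorem Int.ringChoose_neg_two (m : ℕ) :
    Ring.choose (-2 : ℤ) m = (-1) ^ m * (m + 1 : ℤ) := by
  rw [Ring.choose_neg, show (2 : ℤ) + m - 1 = ((m + 1 : ℕ) : ℤ) by push_cast; ring,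
    Ring.choose_natCast, Nat.choose_succ_self_right]
  simp [Int.negOnePow, Units.smul_def, mul_add]

/-- Theorem 4: if `k ≥ 3` and `H` is a `k`-uniform hypergraph on `n` vertices in which
no two edges intersect in exactly one vertex, then `H` has at most `C(n, k-2)` edges. -/
theorem card_le_of_no_pair_intersecting_in_one (k n : ℕ) (hk : 3 ≤ k)
    (H : Finset (Finset (Fin n)))
    (huniform : ∀ e ∈ H, e.card = k)
    (hint : ∀ e₁ ∈ H, ∀ e₂ ∈ H, (e₁ ∩ e₂).card ≠ 1) :
    H.card ≤ Nat.choose n (k - 2) := by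
  obtain ⟨m, rfl⟩ : ∃ m, k = m + 2 := ⟨k - 2, by omega⟩
  have : Fact (1 < m + 1) := ⟨by omega⟩
  let M : Matrix H H ℤ := .of fun A B ↦ Ring.choose (((A.1 ∩ B.1).card : ℤ) + -2) m
  have hM : M.map (Int.castRingHom (ZMod (m + 1))) = 1 := by
    ext A B
    simp only [M, Matrix.map_apply, Matrix.of_apply]
    by_cases hAB : A = B
    · subst hAB
      rw [Finset.inter_self, huniform _ A.2,
        show ((m + 2 : ℕ) : ℤ) + -2 = (m : ℤ) by push_cast; ring, Ring.choose_natCast]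
      simp
    rw [Matrix.one_apply_ne hAB]
    have hlt : (A.1 ∩ B.1).card < m + 2 := by
      rw [← huniform _ A.2]
      refine Finset.card_lt_card (Finset.inter_subset_left.ssubset_of_ne fun h ↦ hAB ?_)
      exact Subtype.ext (Finset.eq_of_subset_of_card_le (Finset.inter_eq_left.1 h)
        (by rw [huniform _ A.2, huniform _ B.2]))
    have hne := hint _ A.2 _ B.2
    obtain h0 | ⟨t, ht⟩ : (A.1 ∩ B.1).card = 0 ∨ ∃ t, (A.1 ∩ B.1).card = t + 2 := by
      by_cases h : (A.1 ∩ B.1).card = 0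
      · exact .inl h
      · exact .inr ⟨(A.1 ∩ B.1).card - 2, by omega⟩
    · have hz : ((m : ZMod (m + 1)) + 1) = 0 := by exact_mod_cast ZMod.natCast_self (m + 1)
      rw [h0, Nat.cast_zero, zero_add, Int.ringChoose_neg_two]
      simp [hz]
    · rw [ht, show ((t + 2 : ℕ) : ℤ) + -2 = (t : ℤ) by push_cast; ring, Ring.choose_natCast,
        Nat.choose_eq_zero_of_lt (by omega)]
      simp
  choose f hf using Finset.exists_sum_powersetCard_eq_ringChoose (α := Fin n)
    (show m ≤ m + 2 by omega) (-2)
  let P := (Finset.univ : Finset (Fin n)).powersetCard m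
  let X : Matrix H P ℚ := .of fun A S ↦ f A.1 S.1
  let W : Matrix P H ℚ := .of fun S B ↦ if S.1 ⊆ B.1 then 1 else 0
  have hXW : M.map (Int.castRingHom ℚ) = X * W := by
    ext A B
    simp only [M, X, W, Matrix.map_apply, Matrix.of_apply, Matrix.mul_apply, eq_intCast]
    rw [← hf A.1 B.1 (huniform _ B.2),
      Finset.sum_coe_sort P fun S ↦ f A.1 S * if S ⊆ B.1 then 1 else 0]
    simp only [mul_ite, mul_one, mul_zero]
    rw [← Finset.sum_filter]
    refine Finset.sum_congr ?_ fun _ _ ↦ rfl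
    ext S
    simp [P, Finset.mem_powersetCard, and_comm]
  have hunit : IsUnit (M.map (Int.castRingHom ℚ)) := by
    rw [Matrix.isUnit_iff_isUnit_det, isUnit_iff_ne_zero, ← RingHom.mapMatrix_apply,
      ← RingHom.map_det, eq_intCast, Int.cast_ne_zero]
    exact Matrix.det_ne_zero_of_map_zmod_eq_one hM
  calc H.card = (X * W).rank := by rw [← hXW, Matrix.rank_of_isUnit _ hunit, Fintype.card_coe]
    _ ≤ X.rank := Matrix.rank_mul_le_left X W
    _ ≤ P.card := by simpa using X.rank_le_card_width
    _ = n.choose (m + 2 - 2) := by simp [P]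
end
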